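/- arXiv:1612.06501 — 2 statements merged into one kernel-verified Lean document; each statement's English description precedes it below -/
import Mathlib

section
/- Fix μ > 0 and let g : ℝ → ℝ be Bohr almost periodic with inf g > 0, with unique bounded positive steady state u*_g. Let v₁, v₂ : (−∞, 0] × ℝ → ℝ be C² entire solutions of the fixed-boundary equation −μ (v_i)_ξ(0, τ) · (−(v_i)_ξ + (v_i)_τ) = (v_i)_{ξξ} + v_i(g(ξ + τ) − v_i) for ξ < 0, τ ∈ ℝ, with v_i(0, τ) = 0. Assume for all ξ < 0 and τ ∈ ℝ: 0 < v₁(ξ, τ) ≤ v₂(ξ, τ) ≤ u*_g(ξ + τ), −(v₂)_ξ(ξ, τ) + (v₂)_τ(ξ, τ) ≥ 0, (v₂)_ξ(0, τ) < 0, and 0 < ρ(τ) < 1, where ρ(τ) := inf_{ξ < 0} v₁(ξ, τ)/v₂(ξ, τ). Then ρ is nondecreasing on ℝ. Moreover, if liminf_{ξ → −∞} v₁(ξ, τ₀)/v₂(ξ, τ₀) > ρ(τ₀) for some τ₀, then ρ(τ) > ρ(τ₀) for every τ > τ₀. -/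
/-- A function `f : ℝ → ℝ` is Bohr almost periodic if for every `ε > 0` there is `L > 0`
such that every interval of length `L` contains an `ε`-almost period `s`. -/
def BohrAlmostPeriodic (f : ℝ → ℝ) : Prop :=
  ∀ ε > (0 : ℝ), ∃ L > (0 : ℝ), ∀ t : ℝ, ∃ s ∈ Set.Icc t (t + L),
    ∀ x : ℝ, |f (x + s) - f x| < ε

/-- `u` is a bounded positive C² solution of `u'' + u (g x - u) = 0` on `ℝ`. -/
def IsBddPosSteadyState (g u : ℝ → ℝ) : Prop :=
  ContDiff ℝ 2 u ∧ (∃ C : ℝ, ∀ x : ℝ, |u x| ≤ C) ∧ (∀ x : ℝ, 0 < u x) ∧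
    ∀ x : ℝ, deriv (deriv u) x + u x * (g x - u x) = 0

open Set Filter Topology

theorem BohrAlmostPeriodic.exists_upper_bound {g : ℝ → ℝ} (hg : BohrAlmostPeriodic g)
    (hc : Continuous g) : ∃ G : ℝ, 0 ≤ G ∧ ∀ x, g x ≤ G := by
  obtain ⟨L, hL, h⟩ := hg 1 one_pos
  obtain ⟨C, hC⟩ := (isCompact_Icc (a := (0 : ℝ)) (b := L)).exists_bound_of_continuousOn
    hc.continuousOn
  refine ⟨|C| + 1, by positivity, fun x => ?_⟩
  obtain ⟨s, hs, hgs⟩ := h (-x)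
  have h1 := hC (x + s) ⟨by linarith [hs.1], by linarith [hs.2]⟩
  rw [Real.norm_eq_abs] at h1
  linarith [(abs_lt.1 (hgs x)).1, le_abs_self (g (x + s)), le_abs_self C]

theorem IsBddPosSteadyState.continuous_coefficient {g u : ℝ → ℝ}
    (h : IsBddPosSteadyState g u) : Continuous g := by
  obtain ⟨hu, -, hpos, hode⟩ := h
  have h2 : Continuous (deriv (deriv u)) := by
    have := hu.continuous_iteratedDeriv 2 le_rfl
    rwa [iteratedDeriv_succ, iteratedDeriv_one] at this
  have : g = fun x => u x - deriv (deriv u) x / u x := by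
    ext x
    have h0 := (hpos x).ne'
    field_simp
    linarith [hode x]
  rw [this]
  exact hu.continuous.sub (h2.div hu.continuous fun x => (hpos x).ne')

/-- A function with negative left derivative at `x` exceeds `f x` just to the left of `x`. -/
theorem HasDerivWithinAt.eventually_lt_of_neg {f : ℝ → ℝ} {d x : ℝ}
    (hf : HasDerivWithinAt f d (Iic x) x) (hd : d < 0) : ∀ᶠ y in 𝓝[<] x, f x < f y := by
  have h := hasDerivWithinAt_iff_tendsto_slope.1 hf
  rw [Iic_sdiff_right] at h
  filter_upwards [h.eventually (gt_mem_nhds hd), self_mem_nhdsWithin] with y hy hyx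
  rw [slope_def_field, div_neg_iff] at hy
  rcases hy with hy | hy
  · linarith
  · have : y < x := hyx
    linarith

theorem HasDerivWithinAt.nonneg_of_eventually_le {f : ℝ → ℝ} {d x : ℝ}
    (hf : HasDerivWithinAt f d (Iic x) x) (h : ∀ᶠ y in 𝓝[<] x, f y ≤ f x) : 0 ≤ d := by
  by_contra! hd
  obtain ⟨y, h1, h2⟩ := (h.and (hf.eventually_lt_of_neg hd)).exists
  linarith

theorem HasDerivWithinAt.nonpos_of_eventually_ge {f : ℝ → ℝ} {d x : ℝ}
    (hf : HasDerivWithinAt f d (Iic x) x) (h : ∀ᶠ y in 𝓝[<] x, f x ≤ f y) : d ≤ 0 := by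
  have := hf.neg.nonneg_of_eventually_le (h.mono fun y hy => neg_le_neg hy)
  linarith

/-- Second-order necessary condition at a left-sided minimum with vanishing derivative. -/
theorem second_deriv_nonneg_of_left_min {f f' : ℝ → ℝ} {d x : ℝ}
    (hf : ∀ y ≤ x, HasDerivWithinAt f (f' y) (Iic x) y)
    (hf' : HasDerivWithinAt f' d (Iic x) x) (h0 : f' x = 0)
    (hmin : ∀ y < x, f x ≤ f y) : 0 ≤ d := by
  by_contra! hd
  have h := hf'.eventually_lt_of_neg hd
  rw [h0] at h
  obtain ⟨l, hl, hpos⟩ := (mem_nhdsLT_iff_exists_Ioo_subset).1 h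
  have hl' : l < x := hl
  obtain ⟨m, hm⟩ := exists_between hl'
  have hmono : StrictMonoOn f (Icc m x) := by
    apply strictMonoOn_of_deriv_pos (convex_Icc m x)
    · exact fun y hy => ((hf y hy.2).continuousWithinAt).mono Icc_subset_Iic_self
    · intro y hy
      rw [interior_Icc] at hy
      rw [((hf y hy.2.le).hasDerivAt (Iic_mem_nhds hy.2)).deriv]
      exact hpos ⟨hm.1.trans hy.1, hy.2⟩
  have := hmono (left_mem_Icc.2 hm.2.le) (right_mem_Icc.2 hm.2.le) hm.2
  linarith [hmin m hm.2]

/-- Maximum principle on a half strip for functions bounded below. -/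
theorem parabolic_nonneg_of_boundary_nonneg {w wx wt wxx : ℝ → ℝ → ℝ} {c : ℝ → ℝ}
    {b τ₀ T A B c₀ : ℝ} (hb : b ≤ 0) (hA : 0 ≤ A) (hc₀ : 0 < c₀)
    (hcont : ContinuousOn (fun p : ℝ × ℝ => w p.1 p.2) (Iic b ×ˢ Icc τ₀ T))
    (hx : ∀ τ, ∀ ξ < b, HasDerivAt (fun ζ => w ζ τ) (wx ξ τ) ξ)
    (hxx : ∀ τ, ∀ ξ < b, HasDerivAt (fun ζ => wx ζ τ) (wxx ξ τ) ξ)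
    (ht : ∀ τ, ∀ ξ < b, HasDerivAt (fun σ => w ξ σ) (wt ξ τ) τ)
    (hB : ∀ τ, ∀ ξ ≤ b, -B ≤ w ξ τ)
    (hc : ∀ τ ∈ Icc τ₀ T, c₀ ≤ c τ)
    (hineq : ∀ τ ∈ Icc τ₀ T, ∀ ξ < b, w ξ τ < 0 →
      wxx ξ τ + A * w ξ τ ≤ c τ * (-wx ξ τ + wt ξ τ))
    (hinit : ∀ ξ ≤ b, 0 ≤ w ξ τ₀) (hlat : ∀ τ ∈ Icc τ₀ T, 0 ≤ w b τ) :
    ∀ τ ∈ Icc τ₀ T, ∀ ξ ≤ b, 0 ≤ w ξ τ := by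
  intro τs hτs ξs hξs
  by_contra! hneg
  set K : ℝ := (A + 2) / c₀ with hK
  have hKpos : 0 < K := by positivity
  set E : ℝ → ℝ := fun τ => Real.exp (-K * (τ - τ₀)) with hE
  have hEpos : ∀ τ, 0 < E τ := fun τ => Real.exp_pos _
  have hE1 : ∀ τ ∈ Icc τ₀ T, E τ ≤ 1 := fun τ hτ => by
    apply Real.exp_le_one_iff.2
    nlinarith [hτ.1]
  have hEd : ∀ τ, HasDerivAt E (-K * E τ) τ := fun τ => by
    have := (((hasDerivAt_id τ).sub_const τ₀).const_mul (-K)).exp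
    refine this.congr_deriv ?_
    simp [hE, mul_comm]
  set ε : ℝ := -(E τs * w ξs τs) / (2 * (1 + ξs ^ 2)) with hε
  have hEw : E τs * w ξs τs < 0 := mul_neg_of_pos_of_neg (hEpos _) hneg
  have hεpos : 0 < ε := div_pos (by linarith) (by positivity)
  set q : ℝ × ℝ → ℝ := fun p => E p.2 * w p.1 p.2 + ε * (1 + p.1 ^ 2) with hq
  have hqs : q (ξs, τs) < 0 := by
    have : ε * (1 + ξs ^ 2) = -(E τs * w ξs τs) / 2 := by
      rw [hε]; field_simp
    simp only [hq, this]
    linarith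
  have hB0 : 0 < B := by linarith [hB τs ξs hξs]
  have hEcont : Continuous E := by simp only [hE]; fun_prop
  have hqcont : ContinuousOn q (Iic b ×ˢ Icc τ₀ T) :=
    ((hEcont.comp continuous_snd).continuousOn.mul hcont).add (by fun_prop)
  set R : ℝ := -(B / ε + 1) + min ξs 0 with hR
  have hBε : 0 < B / ε := by positivity
  have hRs : R ≤ ξs := by linarith [min_le_left ξs 0]
  have hqfar : ∀ τ ∈ Icc τ₀ T, ∀ ξ ≤ b, ξ < R → 0 < q (ξ, τ) := by
    intro τ hτ ξ hξ hξR
    have h1 : -B ≤ E τ * w ξ τ := by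
      nlinarith [hB τ ξ hξ, hE1 τ hτ, hEpos τ]
    have h2 : B / ε + 1 < -ξ := by linarith [min_le_right ξs 0]
    have h3 : B / ε < 1 + ξ ^ 2 := by nlinarith
    have h4 : B < ε * (1 + ξ ^ 2) := by
      rw [div_lt_iff₀ hεpos] at h3
      linarith
    simp only [hq]
    linarith
  have hsub : Icc R b ×ˢ Icc τ₀ T ⊆ Iic b ×ˢ Icc τ₀ T :=
    prod_mono Icc_subset_Iic_self subset_rfl
  obtain ⟨⟨ξ₁, τ₁⟩, ⟨hξ₁, hτ₁⟩, hmin⟩ := (isCompact_Icc.prod isCompact_Icc).exists_isMinOn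
    ⟨(ξs, τs), ⟨hRs, hξs⟩, hτs⟩ (hqcont.mono hsub)
  simp only at hξ₁ hτ₁
  have hq1 : q (ξ₁, τ₁) < 0 := (hmin ⟨⟨hRs, hξs⟩, hτs⟩ : _ ≤ _).trans_lt hqs
  have hglob : ∀ τ ∈ Icc τ₀ T, ∀ ξ ≤ b, q (ξ₁, τ₁) ≤ q (ξ, τ) := by
    intro τ hτ ξ hξ
    rcases lt_or_ge ξ R with h | h
    · linarith [hqfar τ hτ ξ hξ h]
    · exact hmin ⟨⟨h, hξ⟩, hτ⟩
  have hw1 : E τ₁ * w ξ₁ τ₁ + ε * (1 + ξ₁ ^ 2) < 0 := hq1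
  have hW : E τ₁ * w ξ₁ τ₁ < -ε := by nlinarith [sq_nonneg ξ₁]
  have hwneg : w ξ₁ τ₁ < 0 := by
    by_contra! h
    nlinarith [mul_nonneg (hEpos τ₁).le h]
  have hξb : ξ₁ < b := lt_of_le_of_ne hξ₁.2 fun h => by
    rw [h] at hwneg; linarith [hlat τ₁ hτ₁]
  have hττ : τ₀ < τ₁ := lt_of_le_of_ne hτ₁.1 fun h => by
    rw [← h] at hwneg; linarith [hinit ξ₁ hξ₁.2]
  have hqx : ∀ ξ < b, HasDerivAt (fun ζ => q (ζ, τ₁)) (E τ₁ * wx ξ τ₁ + ε * (2 * ξ)) ξ := by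
    intro ξ hξ
    have h2 : HasDerivAt (fun ζ : ℝ => ε * (1 + ζ ^ 2)) (ε * (2 * ξ)) ξ := by
      simpa using (((hasDerivAt_id ξ).pow 2).const_add 1).const_mul ε
    exact ((hx τ₁ ξ hξ).const_mul (E τ₁)).add h2
  have hqxx : HasDerivAt (fun ζ => E τ₁ * wx ζ τ₁ + ε * (2 * ζ))
      (E τ₁ * wxx ξ₁ τ₁ + ε * 2) ξ₁ := by
    have h2 : HasDerivAt (fun ζ : ℝ => ε * (2 * ζ)) (ε * 2) ξ₁ := by
      simpa using ((hasDerivAt_id ξ₁).const_mul 2).const_mul ε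
    exact ((hxx τ₁ ξ₁ hξb).const_mul (E τ₁)).add h2
  have hqt : HasDerivAt (fun σ => q (ξ₁, σ))
      (-K * E τ₁ * w ξ₁ τ₁ + E τ₁ * wt ξ₁ τ₁) τ₁ :=
    ((hEd τ₁).mul (ht τ₁ ξ₁ hξb)).add_const (ε * (1 + ξ₁ ^ 2))
  have hd0 : E τ₁ * wx ξ₁ τ₁ + ε * (2 * ξ₁) = 0 := by
    have hloc : IsLocalMin (fun ζ => q (ζ, τ₁)) ξ₁ := by
      filter_upwards [Iio_mem_nhds hξb] with ζ hζ
      exact hglob τ₁ hτ₁ ζ (le_of_lt hζ)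
    exact hloc.hasDerivAt_eq_zero (hqx ξ₁ hξb)
  have hd2 : 0 ≤ E τ₁ * wxx ξ₁ τ₁ + ε * 2 :=
    second_deriv_nonneg_of_left_min (f := fun ζ => q (ζ, τ₁))
      (fun y hy => (hqx y (hy.trans_lt hξb)).hasDerivWithinAt) hqxx.hasDerivWithinAt hd0
      fun y hy => hglob τ₁ hτ₁ y (hy.le.trans hξb.le)
  have hdt : -K * E τ₁ * w ξ₁ τ₁ + E τ₁ * wt ξ₁ τ₁ ≤ 0 := by
    refine (hqt.hasDerivWithinAt (s := Iic τ₁)).nonpos_of_eventually_ge ?_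
    filter_upwards [Ioo_mem_nhdsLT hττ] with σ hσ
    exact hglob σ ⟨hσ.1.le, hσ.2.le.trans hτ₁.2⟩ ξ₁ hξ₁.2
  have hp := mul_le_mul_of_nonneg_left (hineq τ₁ hτ₁ ξ₁ hξb hwneg) (hEpos τ₁).le
  have hc1 := hc τ₁ hτ₁
  have hcpos : 0 < c τ₁ := hc₀.trans_le hc1
  have hstep : c τ₁ * (E τ₁ * wt ξ₁ τ₁ - E τ₁ * wx ξ₁ τ₁)
      ≤ c τ₁ * (K * (E τ₁ * w ξ₁ τ₁)) := by
    apply mul_le_mul_of_nonneg_left _ hcpos.le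
    have : ε * ξ₁ ≤ 0 := mul_nonpos_of_nonneg_of_nonpos hεpos.le (hξb.le.trans hb)
    linarith
  have hcK : A + 2 ≤ c τ₁ * K := by
    calc A + 2 = c₀ * K := by rw [hK]; field_simp
      _ ≤ c τ₁ * K := mul_le_mul_of_nonneg_right hc1 hKpos.le
  have hfin : c τ₁ * K * (E τ₁ * w ξ₁ τ₁) ≤ (A + 2) * (E τ₁ * w ξ₁ τ₁) :=
    mul_le_mul_of_nonpos_right hcK (by linarith)
  linarith

/-- `vx`, `vt` and `vxx` are the indicated partial derivatives of `v` on the closed left half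
plane (one-sided in the first variable at the boundary). -/
structure HalfPlaneDerivs (v vx vt vxx : ℝ → ℝ → ℝ) : Prop where
  cont : ContinuousOn (fun p : ℝ × ℝ => v p.1 p.2) (Iic 0 ×ˢ univ)
  contx : ContinuousOn (fun p : ℝ × ℝ => vx p.1 p.2) (Iic 0 ×ˢ univ)
  contt : ContinuousOn (fun p : ℝ × ℝ => vt p.1 p.2) (Iic 0 ×ˢ univ)
  contxx : ContinuousOn (fun p : ℝ × ℝ => vxx p.1 p.2) (Iic 0 ×ˢ univ)
  hx : ∀ τ, ∀ ξ ≤ 0, HasDerivWithinAt (fun ζ => v ζ τ) (vx ξ τ) (Iic 0) ξ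
  hxx : ∀ τ, ∀ ξ ≤ 0, HasDerivWithinAt (fun ζ => vx ζ τ) (vxx ξ τ) (Iic 0) ξ
  ht : ∀ τ, ∀ ξ ≤ 0, HasDerivAt (fun σ => v ξ σ) (vt ξ τ) τ

namespace HalfPlaneDerivs

theorem exists_of_contDiffOn {v : ℝ → ℝ → ℝ}
    (h : ContDiffOn ℝ 2 (fun p : ℝ × ℝ => v p.1 p.2) (Iic 0 ×ˢ univ)) :
    ∃ vx vt vxx, HalfPlaneDerivs v vx vt vxx := by
  set S : Set (ℝ × ℝ) := Iic 0 ×ˢ univ with hS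
  have hU : UniqueDiffOn ℝ S := (uniqueDiffOn_Iic 0).prod uniqueDiffOn_univ
  have hslice : ∀ (F : ℝ × ℝ → ℝ), DifferentiableOn ℝ F S → ∀ τ, ∀ ξ ≤ 0,
      HasDerivWithinAt (fun ζ => F (ζ, τ)) (fderivWithin ℝ F S (ξ, τ) (1, 0)) (Iic 0) ξ := by
    intro F hF τ ξ hξ
    have h1 : HasDerivWithinAt (fun ζ : ℝ => (ζ, τ)) ((1 : ℝ), (0 : ℝ)) (Iic 0) ξ :=
      ((hasDerivAt_id ξ).prodMk (hasDerivAt_const ξ τ)).hasDerivWithinAt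
    have h2 : MapsTo (fun ζ : ℝ => (ζ, τ)) (Iic 0) S := fun ζ hζ => ⟨hζ, mem_univ _⟩
    exact (hF (ξ, τ) (h2 hξ)).hasFDerivWithinAt.comp_hasDerivWithinAt ξ h1 h2
  have h1 := h.fderivWithin hU (m := 1) (by norm_num)
  have hX : ContDiffOn ℝ 1 (fun p => fderivWithin ℝ (fun p : ℝ × ℝ => v p.1 p.2) S p (1, 0)) S :=
    h1.clm_apply contDiffOn_const
  have hT : ContDiffOn ℝ 1 (fun p => fderivWithin ℝ (fun p : ℝ × ℝ => v p.1 p.2) S p (0, 1)) S :=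
    h1.clm_apply contDiffOn_const
  have hXX := (hX.continuousOn_fderivWithin hU le_rfl).clm_apply
    (continuousOn_const (c := ((1 : ℝ), (0 : ℝ))))
  refine ⟨fun ξ τ => fderivWithin ℝ (fun p : ℝ × ℝ => v p.1 p.2) S (ξ, τ) (1, 0),
    fun ξ τ => fderivWithin ℝ (fun p : ℝ × ℝ => v p.1 p.2) S (ξ, τ) (0, 1),
    fun ξ τ => fderivWithin ℝ
      (fun p => fderivWithin ℝ (fun p : ℝ × ℝ => v p.1 p.2) S p (1, 0)) S (ξ, τ) (1, 0),
    h.continuousOn, hX.continuousOn, hT.continuousOn, hXX,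
    hslice _ (h.differentiableOn two_ne_zero), hslice _ (hX.differentiableOn one_ne_zero), ?_⟩
  intro τ ξ hξ
  have h1 : HasDerivWithinAt (fun σ : ℝ => (ξ, σ)) ((0 : ℝ), (1 : ℝ)) univ τ :=
    ((hasDerivAt_const τ ξ).prodMk (hasDerivAt_id τ)).hasDerivWithinAt
  have h2 : MapsTo (fun σ : ℝ => (ξ, σ)) univ S := fun σ _ => ⟨hξ, mem_univ _⟩
  rw [← hasDerivWithinAt_univ]
  exact ((h.differentiableOn two_ne_zero) (ξ, τ)
    (h2 (mem_univ τ))).hasFDerivWithinAt.comp_hasDerivWithinAt τ h1 h2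

variable {v vx vt vxx : ℝ → ℝ → ℝ}

theorem hasDerivAt_x (h : HalfPlaneDerivs v vx vt vxx) (τ : ℝ) {ξ : ℝ} (hξ : ξ < 0) :
    HasDerivAt (fun ζ => v ζ τ) (vx ξ τ) ξ :=
  (h.hx τ ξ hξ.le).hasDerivAt (Iic_mem_nhds hξ)

theorem hasDerivAt_xx (h : HalfPlaneDerivs v vx vt vxx) (τ : ℝ) {ξ : ℝ} (hξ : ξ < 0) :
    HasDerivAt (fun ζ => vx ζ τ) (vxx ξ τ) ξ :=
  (h.hxx τ ξ hξ.le).hasDerivAt (Iic_mem_nhds hξ)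

theorem deriv_deriv_x (h : HalfPlaneDerivs v vx vt vxx) (τ : ℝ) {ξ : ℝ} (hξ : ξ < 0) :
    deriv (deriv fun ζ => v ζ τ) ξ = vxx ξ τ := by
  rw [← (h.hasDerivAt_xx τ hξ).deriv]
  apply EventuallyEq.deriv_eq
  filter_upwards [Iio_mem_nhds hξ] with ζ hζ
  exact (h.hasDerivAt_x τ hζ).deriv

theorem deriv_zero_eq (h : HalfPlaneDerivs v vx vt vxx) {τ : ℝ}
    (h0 : deriv (fun ζ => v ζ τ) 0 ≠ 0) : deriv (fun ζ => v ζ τ) 0 = vx 0 τ :=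
  (uniqueDiffOn_Iic (0 : ℝ) 0 self_mem_Iic).eq_deriv _
    (differentiableAt_of_deriv_ne_zero h0).hasDerivAt.hasDerivWithinAt (h.hx τ 0 le_rfl)

theorem continuousOn_slice {f : ℝ → ℝ → ℝ}
    (h : ContinuousOn (fun p : ℝ × ℝ => f p.1 p.2) (Iic 0 ×ˢ univ)) (τ : ℝ) :
    ContinuousOn (fun ξ => f ξ τ) (Iic 0) :=
  h.comp (f := fun ξ : ℝ => (ξ, τ)) (by fun_prop) fun ξ hξ => ⟨hξ, mem_univ _⟩

theorem continuous_slice {f : ℝ → ℝ → ℝ}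
    (h : ContinuousOn (fun p : ℝ × ℝ => f p.1 p.2) (Iic 0 ×ˢ univ)) {ξ : ℝ} (hξ : ξ ≤ 0) :
    Continuous (fun τ => f ξ τ) := by
  rw [← continuousOn_univ]
  exact h.comp (f := fun τ : ℝ => (ξ, τ)) (by fun_prop) fun τ _ => ⟨hξ, mem_univ _⟩

/-- The free-boundary equation evaluated in the limit at the boundary. -/
theorem xx_zero_eq (h : HalfPlaneDerivs v vx vt vxx) {μ : ℝ} {g : ℝ → ℝ} (hg : Continuous g)
    (h0 : ∀ τ, v 0 τ = 0)
    (hpde : ∀ τ, ∀ ξ < 0, -μ * vx 0 τ * (-vx ξ τ + vt ξ τ)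
      = vxx ξ τ + v ξ τ * (g (ξ + τ) - v ξ τ)) (τ : ℝ) : vxx 0 τ = μ * vx 0 τ ^ 2 := by
  have ht0 : vt 0 τ = 0 := by
    have h1 := h.ht τ 0 le_rfl
    simp only [h0] at h1
    exact h1.unique (hasDerivAt_const τ 0)
  have hv := continuousOn_slice h.cont τ
  have hx := continuousOn_slice h.contx τ
  have ht := continuousOn_slice h.contt τ
  have hxx := continuousOn_slice h.contxx τ
  have hgτ : ContinuousOn (fun ξ => g (ξ + τ)) (Iic 0) :=
    (hg.comp (continuous_id.add continuous_const)).continuousOn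
  have hl : ContinuousOn (fun ξ => -μ * vx 0 τ * (-vx ξ τ + vt ξ τ)) (Iic 0) :=
    continuousOn_const.mul (hx.neg.add ht)
  have hr : ContinuousOn (fun ξ => vxx ξ τ + v ξ τ * (g (ξ + τ) - v ξ τ)) (Iic 0) :=
    hxx.add (hv.mul (hgτ.sub hv))
  have key := EqOn.of_subset_closure (s := Iio 0) (fun ξ hξ => hpde τ ξ hξ) hl hr
    Iio_subset_Iic_self (by rw [closure_Iio]) (self_mem_Iic (a := (0 : ℝ)))
  simp only [h0, ht0] at key
  linarith

end HalfPlaneDerivs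

/-- On the left half line, a bounded positive solution of the stationary Dirichlet problem cannot
lie below a different subsolution that is at most a multiple of it. -/
theorem stationary_eq_of_le_subsolution {p q p' q' p'' q'' G : ℝ → ℝ} {C M : ℝ}
    (hp : ∀ ξ ≤ 0, HasDerivWithinAt p (p' ξ) (Iic 0) ξ)
    (hp' : ∀ ξ ≤ 0, HasDerivWithinAt p' (p'' ξ) (Iic 0) ξ)
    (hq : ∀ ξ ≤ 0, HasDerivWithinAt q (q' ξ) (Iic 0) ξ)
    (hq' : ∀ ξ ≤ 0, HasDerivWithinAt q' (q'' ξ) (Iic 0) ξ)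
    (hp0 : p 0 = 0) (hq0 : q 0 = 0)
    (hpos : ∀ ξ < 0, 0 < p ξ) (hle : ∀ ξ < 0, p ξ ≤ q ξ) (hC : ∀ ξ < 0, p ξ ≤ C)
    (hM : ∀ ξ < 0, q ξ ≤ M * p ξ)
    (hpe : ∀ ξ < 0, p'' ξ + p ξ * (G ξ - p ξ) = 0)
    (hqe : ∀ ξ < 0, 0 ≤ q'' ξ + q ξ * (G ξ - q ξ)) :
    ∀ ξ < 0, p ξ = q ξ := by
  set W : ℝ → ℝ := fun ξ => p ξ * q' ξ - q ξ * p' ξ with hW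
  have hWd : ∀ ξ ≤ 0, HasDerivWithinAt W (p ξ * q'' ξ - q ξ * p'' ξ) (Iic 0) ξ := by
    intro ξ hξ
    refine (((hp ξ hξ).mul (hq' ξ hξ)).sub ((hq ξ hξ).mul (hp' ξ hξ))).congr_deriv ?_
    ring
  have hWge : ∀ ξ < 0, p ξ * q ξ * (q ξ - p ξ) ≤ p ξ * q'' ξ - q ξ * p'' ξ := by
    intro ξ hξ
    have h1 := mul_nonneg (hpos ξ hξ).le (hqe ξ hξ)
    have h2 : q ξ * (p'' ξ + p ξ * (G ξ - p ξ)) = 0 := by rw [hpe ξ hξ, mul_zero]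
    linarith
  have hqpos : ∀ ξ < 0, 0 < q ξ := fun ξ hξ => (hpos ξ hξ).trans_le (hle ξ hξ)
  have hterm : ∀ ξ < 0, 0 ≤ p ξ * q ξ * (q ξ - p ξ) := fun ξ hξ =>
    mul_nonneg (mul_pos (hpos ξ hξ) (hqpos ξ hξ)).le (sub_nonneg.2 (hle ξ hξ))
  have hmono : MonotoneOn W (Iic 0) := by
    refine monotoneOn_of_hasDerivWithinAt_nonneg (f' := fun ξ => p ξ * q'' ξ - q ξ * p'' ξ)
      (convex_Iic 0)
      (fun ξ hξ => (hWd ξ hξ).continuousWithinAt) (fun ξ hξ => ?_) (fun ξ hξ => ?_)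
    · exact (hWd ξ (show ξ ∈ Iic 0 from interior_subset hξ)).mono interior_subset
    · rw [interior_Iic] at hξ
      exact (hterm ξ hξ).trans (hWge ξ hξ)
  have hW0 : W 0 = 0 := by simp [hW, hp0, hq0]
  have hWle : ∀ ξ ≤ 0, W ξ ≤ 0 := fun ξ hξ => hW0 ▸ hmono hξ self_mem_Iic hξ
  have hWzero : ∀ ξ ≤ 0, W ξ = 0 := by
    by_contra! hne
    obtain ⟨ξ₀, hξ₀, hWne⟩ := hne
    have hWneg : W ξ₀ < 0 := lt_of_le_of_ne (hWle ξ₀ hξ₀) hWne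
    have hξ₀' : ξ₀ < 0 := lt_of_le_of_ne hξ₀ fun h => hWne (h ▸ hW0)
    have hCpos : 0 < C := (hpos ξ₀ hξ₀').trans_le (hC ξ₀ hξ₀')
    set k : ℝ := -W ξ₀ / C ^ 2 with hk
    have hkpos : 0 < k := div_pos (by linarith) (by positivity)
    have hrd : ∀ ξ < 0, HasDerivAt (fun ξ => q ξ / p ξ + k * ξ) (W ξ / p ξ ^ 2 + k) ξ := by
      intro ξ hξ
      have hn := Iic_mem_nhds hξ
      refine ((((hq ξ hξ.le).hasDerivAt hn).div ((hp ξ hξ.le).hasDerivAt hn)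
        (hpos ξ hξ).ne').add ((hasDerivAt_id ξ).const_mul k)).congr_deriv ?_
      simp only [hW]
      ring
    have hanti : AntitoneOn (fun ξ => q ξ / p ξ + k * ξ) (Iic ξ₀) := by
      refine antitoneOn_of_hasDerivWithinAt_nonpos (f' := fun ξ => W ξ / p ξ ^ 2 + k)
        (convex_Iic ξ₀)
        (fun ξ hξ => (hrd ξ (lt_of_le_of_lt hξ hξ₀')).continuousAt.continuousWithinAt)
        (fun ξ hξ => (hrd ξ (lt_of_le_of_lt
          (show ξ ∈ Iic ξ₀ from interior_subset hξ) hξ₀')).hasDerivWithinAt)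
        (fun ξ hξ => ?_)
      have hξ' : ξ ∈ Iic ξ₀ := interior_subset hξ
      have hξ0 := lt_of_le_of_lt hξ' hξ₀'
      have h1 : W ξ ≤ W ξ₀ := hmono (hξ0.le) hξ₀ hξ'
      have h2 : 0 < p ξ ^ 2 := pow_pos (hpos ξ hξ0) 2
      have h3 : p ξ ^ 2 ≤ C ^ 2 := pow_le_pow_left₀ (hpos ξ hξ0).le (hC ξ hξ0) 2
      have h4 : k ≤ -W ξ / p ξ ^ 2 := by
        rw [hk]
        exact div_le_div₀ (by linarith) (by linarith) h2 h3
      rw [neg_div] at h4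
      linarith
    have hMk : 0 ≤ M / k := by
      apply div_nonneg _ hkpos.le
      by_contra! hM0
      nlinarith [hM ξ₀ hξ₀', hpos ξ₀ hξ₀', hqpos ξ₀ hξ₀']
    set ξ₁ : ℝ := ξ₀ - M / k with hξ₁
    have hle1 : ξ₁ ≤ ξ₀ := by linarith
    have h1 := hanti hle1 (self_mem_Iic) hle1
    simp only at h1
    have hξ₁0 := hle1.trans_lt hξ₀'
    have h2 : q ξ₁ / p ξ₁ ≤ M := (div_le_iff₀ (hpos ξ₁ hξ₁0)).2 (hM ξ₁ hξ₁0)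
    have h3 : 0 < q ξ₀ / p ξ₀ := div_pos (hqpos ξ₀ hξ₀') (hpos ξ₀ hξ₀')
    have h4 : k * ξ₁ = k * ξ₀ - M := by rw [hξ₁]; field_simp
    linarith
  intro ξ hξ
  have hd : p ξ * q'' ξ - q ξ * p'' ξ = 0 := by
    have h1 : HasDerivWithinAt W 0 (Iic 0) ξ :=
      (hasDerivWithinAt_const ξ (Iic 0) (0 : ℝ)).congr hWzero (hWzero ξ hξ.le)
    exact (uniqueDiffOn_Iic (0 : ℝ) ξ hξ.le).eq_deriv _ (hWd ξ hξ.le) h1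
  have h1 := hWge ξ hξ
  rw [hd] at h1
  have h2 : q ξ - p ξ ≤ 0 := by
    by_contra! h
    exact absurd h1 (not_le.2 (mul_pos (mul_pos (hpos ξ hξ) (hqpos ξ hξ)) h))
  linarith [hle ξ hξ]

/-- Comparison of a solution with a multiple `φ ≤ 1` of a larger solution that is monotone along
characteristics. -/
theorem mul_le_of_initial_of_lateral {μ G C : ℝ} {g : ℝ → ℝ}
    {v₁ v₁x v₁t v₁xx v₂ v₂x v₂t v₂xx : ℝ → ℝ → ℝ} (hμ : 0 < μ)
    (hG : 0 ≤ G) (hgG : ∀ x, g x ≤ G)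
    (d₁ : HalfPlaneDerivs v₁ v₁x v₁t v₁xx) (d₂ : HalfPlaneDerivs v₂ v₂x v₂t v₂xx)
    (hpde₁ : ∀ τ, ∀ ξ < 0, -μ * v₁x 0 τ * (-v₁x ξ τ + v₁t ξ τ)
      = v₁xx ξ τ + v₁ ξ τ * (g (ξ + τ) - v₁ ξ τ))
    (hpde₂ : ∀ τ, ∀ ξ < 0, -μ * v₂x 0 τ * (-v₂x ξ τ + v₂t ξ τ)
      = v₂xx ξ τ + v₂ ξ τ * (g (ξ + τ) - v₂ ξ τ))
    (hmono₂ : ∀ τ, ∀ ξ < 0, 0 ≤ -v₂x ξ τ + v₂t ξ τ)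
    (h₁x : ∀ τ, v₁x 0 τ < 0) (hxx : ∀ τ, v₂x 0 τ ≤ v₁x 0 τ)
    (h₁ : ∀ τ, ∀ ξ ≤ 0, 0 ≤ v₁ ξ τ) (h₂ : ∀ τ, ∀ ξ ≤ 0, 0 ≤ v₂ ξ τ)
    (hC : ∀ τ, ∀ ξ ≤ 0, v₂ ξ τ ≤ C)
    {φ b τ₀ T : ℝ} (hφ : 0 ≤ φ) (hφ1 : φ ≤ 1) (hb : b ≤ 0)
    (hinit : ∀ ξ ≤ b, φ * v₂ ξ τ₀ ≤ v₁ ξ τ₀)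
    (hlat : ∀ τ ∈ Icc τ₀ T, φ * v₂ b τ ≤ v₁ b τ) :
    ∀ τ ∈ Icc τ₀ T, ∀ ξ ≤ b, φ * v₂ ξ τ ≤ v₁ ξ τ := by
  intro τ hτ ξ hξ
  have hccont : Continuous fun τ => -μ * v₁x 0 τ :=
    continuous_const.mul (HalfPlaneDerivs.continuous_slice d₁.contx le_rfl)
  have hcpos : ∀ τ, 0 < -μ * v₁x 0 τ := fun τ => by nlinarith [h₁x τ]
  obtain ⟨τm, -, hτm⟩ := (isCompact_Icc (a := τ₀) (b := T)).exists_isMinOn ⟨τ, hτ⟩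
    hccont.continuousOn
  refine sub_nonneg.1 (parabolic_nonneg_of_boundary_nonneg
    (w := fun ξ τ => v₁ ξ τ - φ * v₂ ξ τ) (wx := fun ξ τ => v₁x ξ τ - φ * v₂x ξ τ)
    (wt := fun ξ τ => v₁t ξ τ - φ * v₂t ξ τ) (wxx := fun ξ τ => v₁xx ξ τ - φ * v₂xx ξ τ)
    (c := fun τ => -μ * v₁x 0 τ) (c₀ := -μ * v₁x 0 τm) (A := G) (B := C)
    hb hG (hcpos τm) ?_ ?_ ?_ ?_ ?_ (fun τ hτ => hτm hτ) ?_ ?_ ?_ τ hτ ξ hξ)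
  · exact (d₁.cont.sub (continuousOn_const.mul d₂.cont)).mono
      (prod_mono (Iic_subset_Iic.2 hb) (subset_univ _))
  · exact fun τ ξ hξ => (d₁.hasDerivAt_x τ (hξ.trans_le hb)).sub
      ((d₂.hasDerivAt_x τ (hξ.trans_le hb)).const_mul φ)
  · exact fun τ ξ hξ => (d₁.hasDerivAt_xx τ (hξ.trans_le hb)).sub
      ((d₂.hasDerivAt_xx τ (hξ.trans_le hb)).const_mul φ)
  · exact fun τ ξ hξ => (d₁.ht τ ξ (hξ.le.trans hb)).sub
      ((d₂.ht τ ξ (hξ.le.trans hb)).const_mul φ)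
  · intro τ ξ hξ
    have hξ0 := hξ.trans hb
    have h3 : φ * v₂ ξ τ ≤ 1 * v₂ ξ τ := mul_le_mul_of_nonneg_right hφ1 (h₂ τ ξ hξ0)
    linarith [hC τ ξ hξ0, h₁ τ ξ hξ0]
  · intro τ hτ ξ hξ hw
    have hξ0 := hξ.trans_le hb
    have e1 := hpde₁ τ ξ hξ0
    have e2 := hpde₂ τ ξ hξ0
    have e3 : -μ * v₁x 0 τ * (-v₂x ξ τ + v₂t ξ τ) ≤ -μ * v₂x 0 τ * (-v₂x ξ τ + v₂t ξ τ) := by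
      apply mul_le_mul_of_nonneg_right _ (hmono₂ τ ξ hξ0)
      nlinarith [hxx τ]
    rw [e2] at e3
    have e4 := mul_le_mul_of_nonneg_left e3 hφ
    have p1 := h₁ τ ξ hξ0.le
    have p2 := h₂ τ ξ hξ0.le
    have e5 : G * (v₁ ξ τ - φ * v₂ ξ τ)
        ≤ (g (ξ + τ) - v₁ ξ τ - φ * v₂ ξ τ) * (v₁ ξ τ - φ * v₂ ξ τ) :=
      mul_le_mul_of_nonpos_right (by nlinarith [hgG (ξ + τ), mul_nonneg hφ p2]) hw.le
    have e6 : 0 ≤ φ * (1 - φ) * v₂ ξ τ ^ 2 :=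
      mul_nonneg (mul_nonneg hφ (by linarith)) (sq_nonneg _)
    linarith
  · exact fun ξ hξ => sub_nonneg.2 (hinit ξ hξ)
  · exact fun τ hτ => sub_nonneg.2 (hlat τ hτ)

theorem ratio_infimum_monotone (μ : ℝ) (hμ : 0 < μ) (g ustar : ℝ → ℝ)
    (hg : BohrAlmostPeriodic g) (hginf : ∃ m > (0 : ℝ), ∀ x : ℝ, m ≤ g x)
    (hstar : IsBddPosSteadyState g ustar)
    (v₁ v₂ : ℝ → ℝ → ℝ)
    (hv₁C2 : ContDiffOn ℝ 2 (fun p : ℝ × ℝ => v₁ p.1 p.2)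
      (Set.Iic 0 ×ˢ (Set.univ : Set ℝ)))
    (hv₂C2 : ContDiffOn ℝ 2 (fun p : ℝ × ℝ => v₂ p.1 p.2)
      (Set.Iic 0 ×ˢ (Set.univ : Set ℝ)))
    (hbdry : ∀ τ : ℝ, v₁ 0 τ = 0 ∧ v₂ 0 τ = 0)
    (hpde₁ : ∀ τ : ℝ, ∀ ξ < (0 : ℝ),
      -μ * deriv (fun ζ => v₁ ζ τ) 0 *
          (-(deriv (fun ζ => v₁ ζ τ) ξ) + deriv (fun σ => v₁ ξ σ) τ)
        = deriv (deriv fun ζ => v₁ ζ τ) ξ + v₁ ξ τ * (g (ξ + τ) - v₁ ξ τ))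
    (hpde₂ : ∀ τ : ℝ, ∀ ξ < (0 : ℝ),
      -μ * deriv (fun ζ => v₂ ζ τ) 0 *
          (-(deriv (fun ζ => v₂ ζ τ) ξ) + deriv (fun σ => v₂ ξ σ) τ)
        = deriv (deriv fun ζ => v₂ ζ τ) ξ + v₂ ξ τ * (g (ξ + τ) - v₂ ξ τ))
    (horder : ∀ τ : ℝ, ∀ ξ < (0 : ℝ),
      0 < v₁ ξ τ ∧ v₁ ξ τ ≤ v₂ ξ τ ∧ v₂ ξ τ ≤ ustar (ξ + τ))
    (hmono₂ : ∀ τ : ℝ, ∀ ξ < (0 : ℝ),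
      0 ≤ -(deriv (fun ζ => v₂ ζ τ) ξ) + deriv (fun σ => v₂ ξ σ) τ)
    (hv₂x : ∀ τ : ℝ, deriv (fun ζ => v₂ ζ τ) 0 < 0)
    (ρ : ℝ → ℝ)
    (hρ : ∀ τ : ℝ, ρ τ = sInf ((fun ξ => v₁ ξ τ / v₂ ξ τ) '' Set.Iio 0))
    (hρbound : ∀ τ : ℝ, 0 < ρ τ ∧ ρ τ < 1) :
    Monotone ρ ∧
      ∀ τ₀ : ℝ,
        ρ τ₀ < Filter.liminf (fun ξ => v₁ ξ τ₀ / v₂ ξ τ₀) Filter.atBot →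
        ∀ τ : ℝ, τ₀ < τ → ρ τ₀ < ρ τ := by
  obtain ⟨-, hubd, -, -⟩ := id hstar
  obtain ⟨C, hC⟩ := hubd
  have hgc : Continuous g := hstar.continuous_coefficient
  obtain ⟨G, hG, hgG⟩ := hg.exists_upper_bound hgc
  obtain ⟨v₁x, v₁t, v₁xx, d₁⟩ := HalfPlaneDerivs.exists_of_contDiffOn hv₁C2
  obtain ⟨v₂x, v₂t, v₂xx, d₂⟩ := HalfPlaneDerivs.exists_of_contDiffOn hv₂C2
  have hpos₂ : ∀ τ, ∀ ξ < 0, 0 < v₂ ξ τ := fun τ ξ hξ =>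
    (horder τ ξ hξ).1.trans_le (horder τ ξ hξ).2.1
  have hvC : ∀ τ, ∀ ξ < 0, v₂ ξ τ ≤ C := fun τ ξ hξ =>
    (horder τ ξ hξ).2.2.trans ((le_abs_self _).trans (hC _))
  have hC0 : 0 ≤ C := (abs_nonneg _).trans (hC 0)
  have hbdd : ∀ τ, BddBelow ((fun ξ => v₁ ξ τ / v₂ ξ τ) '' Iio 0) := fun τ => by
    refine ⟨0, ?_⟩
    rintro _ ⟨ξ, hξ, rfl⟩
    exact (div_pos (horder τ ξ hξ).1 (hpos₂ τ ξ hξ)).le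
  have hρle : ∀ τ, ∀ ξ < 0, ρ τ * v₂ ξ τ ≤ v₁ ξ τ := fun τ ξ hξ => by
    rw [← le_div_iff₀ (hpos₂ τ ξ hξ), hρ τ]
    exact csInf_le (hbdd τ) ⟨ξ, hξ, rfl⟩
  have hleρ : ∀ τ r, (∀ ξ < 0, r * v₂ ξ τ ≤ v₁ ξ τ) → r ≤ ρ τ := fun τ r h => by
    rw [hρ τ]
    refine le_csInf ⟨_, ⟨-1, by simp, rfl⟩⟩ ?_
    rintro _ ⟨ξ, hξ, rfl⟩
    exact (le_div_iff₀ (hpos₂ τ ξ hξ)).2 (h ξ hξ)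
  have hsub₂ : ∀ τ, ∀ ξ < 0, 0 ≤ v₂xx ξ τ + v₂ ξ τ * (g (ξ + τ) - v₂ ξ τ) := fun τ ξ hξ => by
    rw [← d₂.deriv_deriv_x τ hξ, ← hpde₂ τ ξ hξ]
    refine mul_nonneg ?_ (hmono₂ τ ξ hξ)
    nlinarith [hv₂x τ]
  have hne₁ : ∀ τ, deriv (fun ζ => v₁ ζ τ) 0 ≠ 0 := by
    intro τ h0
    have heq := stationary_eq_of_le_subsolution (p := fun ξ => v₁ ξ τ) (q := fun ξ => v₂ ξ τ)
      (G := fun ξ => g (ξ + τ)) (C := C) (M := (ρ τ)⁻¹)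
      (d₁.hx τ) (d₁.hxx τ) (d₂.hx τ) (d₂.hxx τ) (hbdry τ).1 (hbdry τ).2
      (fun ξ hξ => (horder τ ξ hξ).1) (fun ξ hξ => (horder τ ξ hξ).2.1)
      (fun ξ hξ => (horder τ ξ hξ).2.1.trans (hvC τ ξ hξ))
      (fun ξ hξ => by
        rw [inv_mul_eq_div, le_div_iff₀ (hρbound τ).1, mul_comm]
        exact hρle τ ξ hξ)
      (fun ξ hξ => by
        have := hpde₁ τ ξ hξ
        rw [h0, d₁.deriv_deriv_x τ hξ] at this
        linarith)
      (hsub₂ τ)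
    have h1 : 1 ≤ ρ τ := hleρ τ 1 fun ξ hξ => by rw [one_mul]; exact (heq ξ hξ).ge
    linarith [(hρbound τ).2]
  have hdz₁ : ∀ τ, deriv (fun ζ => v₁ ζ τ) 0 = v₁x 0 τ := fun τ => d₁.deriv_zero_eq (hne₁ τ)
  have hdz₂ : ∀ τ, deriv (fun ζ => v₂ ζ τ) 0 = v₂x 0 τ := fun τ => d₂.deriv_zero_eq (hv₂x τ).ne
  have hpde₁' : ∀ τ, ∀ ξ < 0, -μ * v₁x 0 τ * (-v₁x ξ τ + v₁t ξ τ)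
      = v₁xx ξ τ + v₁ ξ τ * (g (ξ + τ) - v₁ ξ τ) := fun τ ξ hξ => by
    have := hpde₁ τ ξ hξ
    rwa [hdz₁, d₁.deriv_deriv_x τ hξ, (d₁.hasDerivAt_x τ hξ).deriv,
      (d₁.ht τ ξ hξ.le).deriv] at this
  have hpde₂' : ∀ τ, ∀ ξ < 0, -μ * v₂x 0 τ * (-v₂x ξ τ + v₂t ξ τ)
      = v₂xx ξ τ + v₂ ξ τ * (g (ξ + τ) - v₂ ξ τ) := fun τ ξ hξ => by
    have := hpde₂ τ ξ hξ
    rwa [hdz₂, d₂.deriv_deriv_x τ hξ, (d₂.hasDerivAt_x τ hξ).deriv,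
      (d₂.ht τ ξ hξ.le).deriv] at this
  have hmono₂' : ∀ τ, ∀ ξ < 0, 0 ≤ -v₂x ξ τ + v₂t ξ τ := fun τ ξ hξ => by
    have := hmono₂ τ ξ hξ
    rwa [(d₂.hasDerivAt_x τ hξ).deriv, (d₂.ht τ ξ hξ.le).deriv] at this
  have h₂x : ∀ τ, v₂x 0 τ < 0 := fun τ => hdz₂ τ ▸ hv₂x τ
  have hdiff : ∀ φ τ, ∀ ξ ≤ 0, HasDerivWithinAt (fun ζ => v₁ ζ τ - φ * v₂ ζ τ)
      (v₁x ξ τ - φ * v₂x ξ τ) (Iic 0) ξ := fun φ τ ξ hξ =>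
    (d₁.hx τ ξ hξ).sub ((d₂.hx τ ξ hξ).const_mul φ)
  have h₁x : ∀ τ, v₁x 0 τ < 0 := fun τ => by
    refine lt_of_le_of_ne ((d₁.hx τ 0 le_rfl).nonpos_of_eventually_ge ?_) (hdz₁ τ ▸ hne₁ τ)
    filter_upwards [self_mem_nhdsWithin] with ξ hξ
    rw [(hbdry τ).1]
    exact (horder τ ξ hξ).1.le
  have hxx : ∀ τ, v₂x 0 τ ≤ v₁x 0 τ := fun τ => by
    have : 0 ≤ v₁x 0 τ - 1 * v₂x 0 τ := by
      refine (hdiff 1 τ 0 le_rfl).nonneg_of_eventually_le ?_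
      filter_upwards [self_mem_nhdsWithin] with ξ hξ
      rw [(hbdry τ).1, (hbdry τ).2]
      linarith [(horder τ ξ hξ).2.1]
    linarith
  have hnn₁ : ∀ τ, ∀ ξ ≤ 0, 0 ≤ v₁ ξ τ := fun τ ξ hξ => by
    rcases hξ.lt_or_eq with h | rfl
    · exact (horder τ ξ h).1.le
    · exact (hbdry τ).1.ge
  have hnn₂ : ∀ τ, ∀ ξ ≤ 0, 0 ≤ v₂ ξ τ := fun τ ξ hξ => by
    rcases hξ.lt_or_eq with h | rfl
    · exact (hpos₂ τ ξ h).le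
    · exact (hbdry τ).2.ge
  have hvC' : ∀ τ, ∀ ξ ≤ 0, v₂ ξ τ ≤ C := fun τ ξ hξ => by
    rcases hξ.lt_or_eq with h | rfl
    · exact hvC τ ξ h
    · rw [(hbdry τ).2]; exact hC0
  have hcomp : ∀ {φ b τ₀ T : ℝ}, 0 ≤ φ → φ ≤ 1 → b ≤ 0 →
      (∀ ξ ≤ b, φ * v₂ ξ τ₀ ≤ v₁ ξ τ₀) → (∀ τ ∈ Icc τ₀ T, φ * v₂ b τ ≤ v₁ b τ) →
      ∀ τ ∈ Icc τ₀ T, ∀ ξ ≤ b, φ * v₂ ξ τ ≤ v₁ ξ τ :=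
    mul_le_of_initial_of_lateral hμ hG hgG d₁ d₂ hpde₁' hpde₂' hmono₂' h₁x hxx hnn₁ hnn₂ hvC'
  have hpersist : ∀ τ₀ τ, τ₀ ≤ τ → ∀ ξ ≤ 0, ρ τ₀ * v₂ ξ τ ≤ v₁ ξ τ := by
    intro τ₀ τ hτ
    refine hcomp (τ₀ := τ₀) (T := τ) (hρbound τ₀).1.le (hρbound τ₀).2.le le_rfl ?_ ?_ τ
      ⟨hτ, le_rfl⟩
    · intro ξ hξ
      rcases hξ.lt_or_eq with h | rfl
      · exact hρle τ₀ ξ h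
      · rw [(hbdry τ₀).1, (hbdry τ₀).2, mul_zero]
    · intro σ _
      rw [(hbdry σ).1, (hbdry σ).2, mul_zero]
  refine ⟨fun τ₀ τ hτ => hleρ τ _ fun ξ hξ => hpersist τ₀ τ hτ ξ hξ.le, ?_⟩
  intro τ₀ hlim τ₁ hτ₁
  obtain ⟨hr0, hr1⟩ := hρbound τ₀
  set r := ρ τ₀
  -- the infimum is not attained in the interior at later times
  have hint : ∀ τ, τ₀ < τ → ∀ ξ < 0, r * v₂ ξ τ < v₁ ξ τ := by
    intro τ hτ ξ hξ
    refine lt_of_le_of_ne (hpersist τ₀ τ hτ.le ξ hξ.le) fun heq => ?_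
    have hw0 : v₁ ξ τ - r * v₂ ξ τ = 0 := by linarith
    have hx0 : v₁x ξ τ - r * v₂x ξ τ = 0 := by
      have hloc : IsLocalMin (fun ζ => v₁ ζ τ - r * v₂ ζ τ) ξ := by
        filter_upwards [Iio_mem_nhds hξ] with ζ hζ
        rw [hw0]
        exact sub_nonneg.2 (hpersist τ₀ τ hτ.le ζ (le_of_lt hζ))
      exact hloc.hasDerivAt_eq_zero ((hdiff r τ ξ hξ.le).hasDerivAt (Iic_mem_nhds hξ))
    have hxx0 : 0 ≤ v₁xx ξ τ - r * v₂xx ξ τ := by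
      refine second_deriv_nonneg_of_left_min (f := fun ζ => v₁ ζ τ - r * v₂ ζ τ)
        (f' := fun ζ => v₁x ζ τ - r * v₂x ζ τ) (x := ξ)
        (fun y hy => (hdiff r τ y (hy.trans hξ.le)).mono (Iic_subset_Iic.2 hξ.le))
        ((d₁.hasDerivAt_xx τ hξ).sub ((d₂.hasDerivAt_xx τ hξ).const_mul r)).hasDerivWithinAt
        hx0 fun y hy => ?_
      rw [hw0]
      exact sub_nonneg.2 (hpersist τ₀ τ hτ.le y (hy.trans hξ).le)
    have ht0 : v₁t ξ τ - r * v₂t ξ τ ≤ 0 := by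
      refine (((d₁.ht τ ξ hξ.le).sub ((d₂.ht τ ξ hξ.le).const_mul r)).hasDerivWithinAt
        (s := Iic τ)).nonpos_of_eventually_ge ?_
      filter_upwards [Ioo_mem_nhdsLT hτ] with σ hσ
      exact hw0.trans_le (sub_nonneg.2 (hpersist τ₀ σ hσ.1.le ξ hξ.le))
    have e1 := hpde₁' τ ξ hξ
    have e2 := hpde₂' τ ξ hξ
    have e3 : -μ * v₁x 0 τ * (-v₂x ξ τ + v₂t ξ τ) ≤ -μ * v₂x 0 τ * (-v₂x ξ τ + v₂t ξ τ) := by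
      apply mul_le_mul_of_nonneg_right _ (hmono₂' τ ξ hξ)
      nlinarith [hxx τ]
    rw [e2] at e3
    have e4 := mul_le_mul_of_nonneg_left e3 hr0.le
    have hc : 0 ≤ -μ * v₁x 0 τ := by nlinarith [h₁x τ]
    have e5 := mul_nonpos_of_nonneg_of_nonpos hc ht0
    have e6 : 0 < r * (1 - r) * v₂ ξ τ ^ 2 :=
      mul_pos (mul_pos hr0 (by linarith)) (pow_pos (hpos₂ τ ξ hξ) 2)
    have e7 : v₁x ξ τ = r * v₂x ξ τ := by linarith
    rw [← heq, e7] at e1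
    nlinarith
  -- nor in the limit at the free boundary
  have hbd : v₁x 0 τ₁ - r * v₂x 0 τ₁ < 0 := by
    have hle : v₁x 0 τ₁ - r * v₂x 0 τ₁ ≤ 0 := by
      refine (hdiff r τ₁ 0 le_rfl).nonpos_of_eventually_ge ?_
      filter_upwards [self_mem_nhdsWithin] with ξ hξ
      rw [(hbdry τ₁).1, (hbdry τ₁).2]
      linarith [hpersist τ₀ τ₁ hτ₁.le ξ (le_of_lt hξ)]
    refine lt_of_le_of_ne hle fun h0 => ?_
    have hxx0 : 0 ≤ v₁xx 0 τ₁ - r * v₂xx 0 τ₁ := by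
      refine second_deriv_nonneg_of_left_min (f := fun ζ => v₁ ζ τ₁ - r * v₂ ζ τ₁)
        (f' := fun ζ => v₁x ζ τ₁ - r * v₂x ζ τ₁) (x := 0) (hdiff r τ₁)
        ((d₁.hxx τ₁ 0 le_rfl).sub ((d₂.hxx τ₁ 0 le_rfl).const_mul r)) h0 fun y hy => ?_
      rw [(hbdry τ₁).1, (hbdry τ₁).2]
      linarith [hpersist τ₀ τ₁ hτ₁.le y hy.le]
    have f1 := d₁.xx_zero_eq hgc (fun τ => (hbdry τ).1) hpde₁' τ₁
    have f2 := d₂.xx_zero_eq hgc (fun τ => (hbdry τ).2) hpde₂' τ₁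
    rw [f1, f2] at hxx0
    have f3 : v₁x 0 τ₁ = r * v₂x 0 τ₁ := by linarith
    rw [f3] at hxx0
    have f4 : 0 < r * (1 - r) * μ * v₂x 0 τ₁ ^ 2 :=
      mul_pos (mul_pos (mul_pos hr0 (by linarith)) hμ) (by have := (h₂x τ₁).ne; positivity)
    linarith
  -- uniform gap near `-∞`
  obtain ⟨s, hrs, hs⟩ := exists_between hlim
  have hbelow : IsBoundedUnder (· ≥ ·) atBot fun ξ => v₁ ξ τ₀ / v₂ ξ τ₀ := by
    refine ⟨0, ?_⟩
    rw [eventually_map]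
    filter_upwards [eventually_lt_atBot 0] with ξ hξ
    exact (div_pos (horder τ₀ ξ hξ).1 (hpos₂ τ₀ ξ hξ)).le
  obtain ⟨N, hN⟩ := eventually_atBot.1 (eventually_lt_of_lt_liminf hs hbelow)
  obtain ⟨b, hb0, hbN⟩ : ∃ b < 0, b ≤ N :=
    ⟨min (-1) N, (min_le_left _ _).trans_lt (by norm_num), min_le_right _ _⟩
  have hinit : ∀ ξ ≤ b, s * v₂ ξ τ₀ ≤ v₁ ξ τ₀ := fun ξ hξ =>
    (le_div_iff₀ (hpos₂ τ₀ ξ (hξ.trans_lt hb0))).1 (hN ξ (hξ.trans hbN)).le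
  have hlatcont : Continuous fun τ => v₁ b τ / v₂ b τ :=
    (HalfPlaneDerivs.continuous_slice d₁.cont hb0.le).div
      (HalfPlaneDerivs.continuous_slice d₂.cont hb0.le) fun τ => (hpos₂ τ b hb0).ne'
  obtain ⟨τm, hτm, hmin⟩ := (isCompact_Icc (a := τ₀) (b := τ₁)).exists_isMinOn
    ⟨τ₀, le_rfl, hτ₁.le⟩ hlatcont.continuousOn
  have hrm : r < v₁ b τm / v₂ b τm := by
    rw [lt_div_iff₀ (hpos₂ τm b hb0)]
    rcases hτm.1.lt_or_eq with h | rfl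
    · exact hint τm h b hb0
    · exact (mul_lt_mul_of_pos_right hrs (hpos₂ τ₀ b hb0)).trans_le (hinit b le_rfl)
  set φ := min s (v₁ b τm / v₂ b τm) with hφ
  have hrφ : r < φ := lt_min hrs hrm
  have hφ1 : φ ≤ 1 := (min_le_right _ _).trans
    ((div_le_one (hpos₂ τm b hb0)).2 (horder τm b hb0).2.1)
  have hfar : ∀ ξ ≤ b, φ * v₂ ξ τ₁ ≤ v₁ ξ τ₁ := by
    refine hcomp (τ₀ := τ₀) (T := τ₁) (hr0.trans hrφ).le hφ1 hb0.le (fun ξ hξ => ?_)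
      (fun τ hτ => ?_) τ₁ ⟨hτ₁.le, le_rfl⟩
    · exact (mul_le_mul_of_nonneg_right (min_le_left _ _) (hnn₂ τ₀ ξ (hξ.trans hb0.le))).trans
        (hinit ξ hξ)
    · rw [← le_div_iff₀ (hpos₂ τ b hb0)]
      exact (min_le_right _ _).trans (hmin hτ)
  -- uniform gap near the free boundary
  obtain ⟨ψ, hrψ, hψ⟩ : ∃ ψ, r < ψ ∧ v₁x 0 τ₁ - ψ * v₂x 0 τ₁ < 0 := by
    have hrlt : r < v₁x 0 τ₁ / v₂x 0 τ₁ := by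
      rw [lt_div_iff_of_neg (h₂x τ₁)]; linarith
    obtain ⟨ψ, h1, h2⟩ := exists_between hrlt
    rw [lt_div_iff_of_neg (h₂x τ₁)] at h2
    exact ⟨ψ, h1, by linarith⟩
  have hnear := (hdiff ψ τ₁ 0 le_rfl).eventually_lt_of_neg hψ
  rw [(hbdry τ₁).1, (hbdry τ₁).2, mul_zero, sub_zero] at hnear
  obtain ⟨η, hη, hηpos⟩ := (mem_nhdsLT_iff_exists_Ioo_subset).1 hnear
  have hη0 : η < 0 := hη
  -- and in between, by compactness
  set e := max b (η / 2) with he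
  have he0 : e < 0 := max_lt hb0 (by linarith)
  have hmidcont : ContinuousOn (fun ξ => v₁ ξ τ₁ / v₂ ξ τ₁) (Icc b e) :=
    ((HalfPlaneDerivs.continuousOn_slice d₁.cont τ₁).mono fun ξ hξ => hξ.2.trans he0.le).div
      ((HalfPlaneDerivs.continuousOn_slice d₂.cont τ₁).mono fun ξ hξ => hξ.2.trans he0.le)
      fun ξ hξ => (hpos₂ τ₁ ξ (hξ.2.trans_lt he0)).ne'
  obtain ⟨ξm, hξm, hξmin⟩ := isCompact_Icc.exists_isMinOn
    ⟨b, le_rfl, le_max_left _ _⟩ hmidcont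
  have hξm0 : ξm < 0 := hξm.2.trans_lt he0
  have hrmid : r < v₁ ξm τ₁ / v₂ ξm τ₁ :=
    (lt_div_iff₀ (hpos₂ τ₁ ξm hξm0)).2 (hint τ₁ hτ₁ ξm hξm0)
  refine (lt_min (lt_min hrφ hrψ) hrmid).trans_le (hleρ τ₁ _ fun ξ hξ => ?_)
  rw [← le_div_iff₀ (hpos₂ τ₁ ξ hξ)]
  rcases le_or_gt ξ b with h | h
  · exact (min_le_left _ _).trans ((min_le_left _ _).trans
      ((le_div_iff₀ (hpos₂ τ₁ ξ hξ)).2 (hfar ξ h)))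
  rcases le_or_gt ξ e with h' | h'
  · exact (min_le_right _ _).trans (hξmin ⟨h.le, h'⟩)
  · refine (min_le_left _ _).trans ((min_le_right _ _).trans
      ((le_div_iff₀ (hpos₂ τ₁ ξ hξ)).2 ?_))
    have h3 : 0 < v₁ ξ τ₁ - ψ * v₂ ξ τ₁ :=
      hηpos ⟨by linarith [le_max_right b (η / 2)], hξ⟩
    linarith
end

section
/- Fix μ > 0 and let a : ℝ → ℝ be Bohr almost periodic with inf a > 0. If (u₁, h₁) and (u₂, h₂) are both almost periodic semi-wave solutions of (FBP_a) connecting u*_a and 0, then they agree up to a time translation: there exists t₀ ∈ ℝ such that h₁(t) = h₂(t + t₀) for all t ∈ ℝ and u₁(x, t) = u₂(x, t + t₀) for all t ∈ ℝ and x ≤ h₁(t). -/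
/-- `(u, h)` is a classical solution of the free boundary problem
`u_t = u_xx + u (g x - u)` for `x < h t`, `u (h t) t = 0`, `h' t = -μ u_x (h t) t`,
for times `t` in the set `J`. -/
structure IsFBPSol (μ : ℝ) (g : ℝ → ℝ) (J : Set ℝ) (u : ℝ → ℝ → ℝ) (h : ℝ → ℝ) : Prop where
  h_diff : ∀ t ∈ J, DifferentiableAt ℝ h t
  h_deriv_cont : ContinuousOn (deriv h) J
  u_cont : ContinuousOn (fun p : ℝ × ℝ => u p.1 p.2) {p : ℝ × ℝ | p.2 ∈ J ∧ p.1 ≤ h p.2}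
  u_reg_x : ∀ t ∈ J, ∀ x < h t, DifferentiableAt ℝ (fun y => u y t) x ∧
      DifferentiableAt ℝ (deriv fun y => u y t) x
  u_reg_t : ∀ t ∈ J, ∀ x < h t, DifferentiableAt ℝ (fun s => u x s) t
  pde : ∀ t ∈ J, ∀ x < h t,
      deriv (fun s => u x s) t = deriv (deriv fun y => u y t) x + u x t * (g x - u x t)
  bdry : ∀ t ∈ J, u (h t) t = 0
  stefan : ∀ t ∈ J, deriv h t = -μ * deriv (fun y => u y t) (h t)

/-- The profile `v (ξ, τ) = u (ξ + τ, h⁻¹ τ)` of a solution with strictly monotone front `h`. -/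
noncomputable def profile (u : ℝ → ℝ → ℝ) (h : ℝ → ℝ) (ξ τ : ℝ) : ℝ :=
  u (ξ + τ) (Function.invFun h τ)

/-- `(u, h)` is an almost periodic semi-wave solution of the free boundary problem
connecting the steady state `ustar` and `0`. -/
structure IsAPSemiWave (μ : ℝ) (g ustar : ℝ → ℝ) (u : ℝ → ℝ → ℝ) (h : ℝ → ℝ) : Prop where
  sol : IsFBPSol μ g Set.univ u h
  bdd : ∃ C : ℝ, ∀ x t : ℝ, |u x t| ≤ C
  pos : ∀ t : ℝ, ∀ x < h t, 0 < u x t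
  mono : StrictMono h
  tendsto_top : Filter.Tendsto h Filter.atTop Filter.atTop
  tendsto_bot : Filter.Tendsto h Filter.atBot Filter.atBot
  almost_periodic : ∀ ε > (0 : ℝ), ∃ L > (0 : ℝ), ∀ r : ℝ, ∃ s ∈ Set.Icc r (r + L),
      ∀ ξ ≤ (0 : ℝ), ∀ τ : ℝ, |profile u h ξ (τ + s) - profile u h ξ τ| < ε
  connects : ∀ ε > (0 : ℝ), ∃ X : ℝ, ∀ ξ ≤ X, ∀ τ : ℝ,
      |profile u h ξ τ - ustar (ξ + τ)| < ε

open Filter Topology Set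

/-- `U` has time derivative `ut` and first and second space derivatives `ux`, `uxx`
at the point `(x, t)`. -/
structure HasJet (U : ℝ → ℝ → ℝ) (x t ut ux uxx : ℝ) : Prop where
  dt : HasDerivAt (fun s => U x s) ut t
  ev : ∀ᶠ y in 𝓝 x, DifferentiableAt ℝ (fun z => U z t) y
  dx : HasDerivAt (fun z => U z t) ux x
  dxx : HasDerivAt (deriv fun z => U z t) uxx x

namespace HasJet

variable {U V : ℝ → ℝ → ℝ} {x t ut ux uxx vt vx vxx : ℝ}

theorem add (hU : HasJet U x t ut ux uxx) (hV : HasJet V x t vt vx vxx) :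
    HasJet (fun x t => U x t + V x t) x t (ut + vt) (ux + vx) (uxx + vxx) where
  dt := hU.dt.add hV.dt
  ev := by
    filter_upwards [hU.ev, hV.ev] with y h1 h2 using h1.add h2
  dx := hU.dx.add hV.dx
  dxx := by
    refine (hU.dxx.add hV.dxx).congr_of_eventuallyEq ?_
    filter_upwards [hU.ev, hV.ev] with y h1 h2
    exact deriv_fun_add h1 h2

theorem mul (hU : HasJet U x t ut ux uxx) (hV : HasJet V x t vt vx vxx) :
    HasJet (fun x t => U x t * V x t) x t (ut * V x t + U x t * vt)
      (ux * V x t + U x t * vx) (uxx * V x t + 2 * (ux * vx) + U x t * vxx) where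
  dt := hU.dt.mul hV.dt
  ev := by
    filter_upwards [hU.ev, hV.ev] with y h1 h2 using h1.mul h2
  dx := hU.dx.mul hV.dx
  dxx := by
    have h := (hU.dxx.mul hV.dx).add (hU.dx.mul hV.dxx)
    rw [hU.dx.deriv, hV.dx.deriv] at h
    refine (h.congr_of_eventuallyEq ?_).congr_deriv (by ring)
    filter_upwards [hU.ev, hV.ev] with y h1 h2
    simpa using deriv_fun_mul h1 h2

theorem of_time {q : ℝ → ℝ} {q' : ℝ} (x : ℝ) (h : HasDerivAt q q' t) :
    HasJet (fun _ s => q s) x t q' 0 0 where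
  dt := h
  ev := Eventually.of_forall fun y => differentiableAt_const _
  dx := hasDerivAt_const _ _
  dxx := by
    have : (deriv fun _ : ℝ => q t) = fun _ => 0 := by ext; simp
    rw [this]; exact hasDerivAt_const _ _

theorem const (c x t : ℝ) : HasJet (fun _ _ => c) x t 0 0 0 :=
  of_time x (hasDerivAt_const t c)

theorem sub (hU : HasJet U x t ut ux uxx) (hV : HasJet V x t vt vx vxx) :
    HasJet (fun x t => U x t - V x t) x t (ut - vt) (ux - vx) (uxx - vxx) := by
  have h := hU.add ((const (-1) x t).mul hV)
  convert h using 1 <;> first | (ext; ring) | ring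

theorem const_mul (c : ℝ) (hU : HasJet U x t ut ux uxx) :
    HasJet (fun x t => c * U x t) x t (c * ut) (c * ux) (c * uxx) := by
  convert (const c x t).mul hU using 1 <;> ring

/-- Jet of a profile moving with a front. -/
theorem moving {g g' g'' : ℝ → ℝ} {h : ℝ → ℝ} {h' : ℝ} (x : ℝ)
    (hg : ∀ y, HasDerivAt g (g' y) y) (hg' : ∀ y, HasDerivAt g' (g'' y) y)
    (hh : HasDerivAt h h' t) :
    HasJet (fun x t => g (x - h t)) x t (-h' * g' (x - h t)) (g' (x - h t)) (g'' (x - h t)) where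
  dt := by
    have := (hg (x - h t)).comp t (hh.const_sub x)
    exact this.congr_deriv (by ring)
  ev := Eventually.of_forall fun y =>
    ((hg (y - h t)).comp_sub_const y (h t)).differentiableAt
  dx := (hg (x - h t)).comp_sub_const x (h t)
  dxx := by
    have e : (deriv fun z => g (z - h t)) = fun z => g' (z - h t) := by
      ext z; exact ((hg (z - h t)).comp_sub_const z (h t)).deriv
    rw [e]; exact (hg' (x - h t)).comp_sub_const x (h t)

/-- Jet of a time-reparametrized function. -/
theorem reparam {θ : ℝ → ℝ} {θ' : ℝ} (hU : HasJet U x (θ t) ut ux uxx)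
    (hθ : HasDerivAt θ θ' t) :
    HasJet (fun x t => U x (θ t)) x t (θ' * ut) ux uxx where
  dt := (hU.dt.comp t hθ).congr_deriv (by ring)
  ev := hU.ev
  dx := hU.dx
  dxx := hU.dxx

end HasJet

theorem second_deriv_nonpos_of_isLocalMax {f : ℝ → ℝ} {x f'' : ℝ} (hx : IsLocalMax f x)
    (hc : ContinuousAt f x) (h2 : HasDerivAt (deriv f) f'' x) : f'' ≤ 0 := by
  by_contra! hpos
  have h0 : deriv f x = 0 := hx.deriv_eq_zero
  have hmin : IsLocalMin f x :=
    isLocalMin_of_deriv_deriv_pos (by rw [h2.deriv]; exact hpos) h0 hc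
  have hconst : f =ᶠ[𝓝 x] fun _ => f x := by
    filter_upwards [hx, hmin] with y h1 h2 using le_antisymm h1 h2
  have h3 : deriv f =ᶠ[𝓝 x] fun _ => 0 := by
    refine hconst.deriv.trans (Eventually.of_forall fun y => by simp)
  have h4 : f'' = 0 := by
    rw [← h2.deriv, h3.deriv_eq]; simp
  linarith

theorem deriv_nonneg_of_left_max {f : ℝ → ℝ} {t f' : ℝ} (h : HasDerivAt f f' t)
    (hm : ∀ᶠ s in 𝓝[<] t, f s ≤ f t) : 0 ≤ f' := by
  have h1 := (hasDerivWithinAt_iff_tendsto_slope' (s := Iio t) (by simp)).1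
    (h.hasDerivWithinAt (s := Iio t))
  refine ge_of_tendsto h1 ?_
  filter_upwards [hm, self_mem_nhdsWithin] with s hs hst
  rw [slope_def_field]
  exact div_nonneg_of_nonpos (by linarith) (by simp at hst; linarith)

theorem isCompact_between {l r : ℝ → ℝ} (hl : Continuous l) (hr : Continuous r) (t₀ t₁ : ℝ) :
    IsCompact {p : ℝ × ℝ | p.2 ∈ Icc t₀ t₁ ∧ l p.2 ≤ p.1 ∧ p.1 ≤ r p.2} := by
  obtain ⟨L, hL⟩ := (isCompact_Icc (a := t₀) (b := t₁)).bddBelow_image hl.continuousOn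
  obtain ⟨R, hR⟩ := (isCompact_Icc (a := t₀) (b := t₁)).bddAbove_image hr.continuousOn
  refine (isCompact_Icc.prod isCompact_Icc : IsCompact (Icc L R ×ˢ Icc t₀ t₁)).of_isClosed_subset
    ?_ ?_
  · refine IsClosed.inter (isClosed_Icc.preimage continuous_snd) (IsClosed.inter ?_ ?_)
    · exact isClosed_le (hl.comp continuous_snd) continuous_fst
    · exact isClosed_le continuous_fst (hr.comp continuous_snd)
  · rintro ⟨x, t⟩ ⟨ht, h1, h2⟩
    exact ⟨⟨(hL ⟨t, ht, rfl⟩).trans h1, h2.trans (hR ⟨t, ht, rfl⟩)⟩, ht⟩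

/-- Comparison principle on a bounded time interval: `U ≤ Z` as soon as this holds on the
parabolic boundary and no multiple `k Z` with `k > 1` can touch `U` from above. -/
theorem le_of_no_touching {l r : ℝ → ℝ} (hl : Continuous l) (hr : Continuous r) {t₀ t₁ : ℝ}
    {U Z : ℝ → ℝ → ℝ}
    (hU : ContinuousOn (fun p : ℝ × ℝ => U p.1 p.2)
      {p : ℝ × ℝ | p.2 ∈ Icc t₀ t₁ ∧ l p.2 ≤ p.1 ∧ p.1 ≤ r p.2})
    (hZ : ContinuousOn (fun p : ℝ × ℝ => Z p.1 p.2)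
      {p : ℝ × ℝ | p.2 ∈ Icc t₀ t₁ ∧ l p.2 ≤ p.1 ∧ p.1 ≤ r p.2})
    (hpos : ∀ t ∈ Icc t₀ t₁, ∀ x, l t ≤ x → x ≤ r t → 0 < Z x t)
    (hbot : ∀ x, l t₀ ≤ x → x ≤ r t₀ → U x t₀ ≤ Z x t₀)
    (hleft : ∀ t ∈ Icc t₀ t₁, l t ≤ r t → U (l t) t ≤ Z (l t) t)
    (hright : ∀ t ∈ Icc t₀ t₁, l t ≤ r t → U (r t) t ≤ Z (r t) t)
    (hstep : ∀ t ∈ Ioc t₀ t₁, ∀ x, l t < x → x < r t → ∀ k > 1, U x t = k * Z x t →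
      ∃ ut ux uxx zt zx zxx, HasJet U x t ut ux uxx ∧ HasJet Z x t zt zx zxx ∧
        (ux = k * zx → uxx ≤ k * zxx → ut < k * zt)) :
    ∀ t ∈ Icc t₀ t₁, ∀ x, l t ≤ x → x ≤ r t → U x t ≤ Z x t := by
  intro t ht x hx1 hx2
  by_contra! hlt
  set R := {p : ℝ × ℝ | p.2 ∈ Icc t₀ t₁ ∧ l p.2 ≤ p.1 ∧ p.1 ≤ r p.2} with hRdef
  have hRc : IsCompact R := isCompact_between hl hr t₀ t₁
  have hq : ContinuousOn (fun p : ℝ × ℝ => U p.1 p.2 / Z p.1 p.2) R :=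
    hU.div hZ fun p hp => (hpos p.2 hp.1 p.1 hp.2.1 hp.2.2).ne'
  obtain ⟨⟨y, s⟩, hys, hmax⟩ := hRc.exists_isMaxOn ⟨(x, t), ht, hx1, hx2⟩ hq
  obtain ⟨hs, hy1, hy2⟩ := hys
  simp only at hs hy1 hy2
  have hZ0 := hpos s hs y hy1 hy2
  set k := U y s / Z y s with hk
  have hk1 : 1 < k := by
    have h1 : U x t / Z x t ≤ k := hmax (a := (x, t)) ⟨ht, hx1, hx2⟩
    have h2 : 1 < U x t / Z x t := (one_lt_div (hpos t ht x hx1 hx2)).2 hlt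
    linarith
  have hUk : U y s = k * Z y s := by rw [hk]; field_simp
  have hgt : Z y s < U y s := by rw [hUk]; nlinarith
  have hy1' : l s < y := by
    rcases hy1.lt_or_eq with h | h
    · exact h
    · subst h; linarith [hleft s hs hy2]
  have hy2' : y < r s := by
    rcases hy2.lt_or_eq with h | h
    · exact h
    · subst h; linarith [hright s hs hy1]
  have hs0 : t₀ < s := by
    rcases hs.1.lt_or_eq with h | h
    · exact h
    · subst h; linarith [hbot y hy1 hy2]
  have hle : ∀ p ∈ R, U p.1 p.2 - k * Z p.1 p.2 ≤ 0 := by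
    intro p hp
    have h1 : U p.1 p.2 / Z p.1 p.2 ≤ k := hmax hp
    rw [div_le_iff₀ (hpos p.2 hp.1 p.1 hp.2.1 hp.2.2)] at h1
    linarith
  obtain ⟨ut, ux, uxx, zt, zx, zxx, jU, jZ, himp⟩ := hstep s ⟨hs0, hs.2⟩ y hy1' hy2' k hk1 hUk
  have jD := jU.sub (jZ.const_mul k)
  have hxmax : IsLocalMax (fun z => U z s - k * Z z s) y := by
    filter_upwards [Ioo_mem_nhds hy1' hy2'] with z hz
    rw [hUk, sub_self]
    exact hle (z, s) ⟨hs, hz.1.le, hz.2.le⟩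
  have hx0 := hxmax.hasDerivAt_eq_zero jD.dx
  have hxx := second_deriv_nonpos_of_isLocalMax hxmax jD.dx.continuousAt jD.dxx
  have htm := deriv_nonneg_of_left_max jD.dt (by
    have e1 : ∀ᶠ τ in 𝓝 s, l τ < y := hl.continuousAt.eventually_lt continuousAt_const hy1'
    have e2 : ∀ᶠ τ in 𝓝 s, y < r τ := continuousAt_const.eventually_lt hr.continuousAt hy2'
    have e3 : ∀ᶠ τ in 𝓝 s, t₀ < τ := lt_mem_nhds hs0
    filter_upwards [nhdsWithin_le_nhds e1, nhdsWithin_le_nhds e2, nhdsWithin_le_nhds e3,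
      self_mem_nhdsWithin] with τ h1 h2 h3 h4
    rw [hUk, sub_self]
    exact hle (y, τ) ⟨⟨h3.le, (le_of_lt h4).trans hs.2⟩, h1.le, h2.le⟩)
  have := himp (by linarith) (by linarith)
  linarith

/-- Comparison principle for ancient solutions: boundedness of `U / Z` replaces the initial
condition, provided the differential inequality is strict. -/
theorem le_of_no_touching_ancient {l r : ℝ → ℝ} (hl : Continuous l) (hr : Continuous r)
    {t₁ η C : ℝ} (hη : 0 < η) {U Z : ℝ → ℝ → ℝ}
    (hU : ContinuousOn (fun p : ℝ × ℝ => U p.1 p.2)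
      {p : ℝ × ℝ | p.2 ≤ t₁ ∧ l p.2 ≤ p.1 ∧ p.1 ≤ r p.2})
    (hZ : ContinuousOn (fun p : ℝ × ℝ => Z p.1 p.2)
      {p : ℝ × ℝ | p.2 ≤ t₁ ∧ l p.2 ≤ p.1 ∧ p.1 ≤ r p.2})
    (hpos : ∀ t ≤ t₁, ∀ x, l t ≤ x → x ≤ r t → 0 < Z x t)
    (hbdd : ∀ t ≤ t₁, ∀ x, l t ≤ x → x ≤ r t → U x t ≤ C * Z x t)
    (hleft : ∀ t ≤ t₁, l t ≤ r t → U (l t) t ≤ Z (l t) t)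
    (hright : ∀ t ≤ t₁, l t ≤ r t → U (r t) t ≤ Z (r t) t)
    (hstep : ∀ t ≤ t₁, ∀ x, l t < x → x < r t → ∀ k > 1, U x t = k * Z x t →
      ∃ ut ux uxx zt zx zxx, HasJet U x t ut ux uxx ∧ HasJet Z x t zt zx zxx ∧
        (ux = k * zx → uxx ≤ k * zxx → ut + η * k * Z x t < k * zt)) :
    ∀ x, l t₁ ≤ x → x ≤ r t₁ → U x t₁ ≤ Z x t₁ := by
  intro x hx1 hx2
  set t₀ := t₁ - |C| / η with ht0
  have hC : 0 ≤ |C| / η := by positivity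
  have hsub : {p : ℝ × ℝ | p.2 ∈ Icc t₀ t₁ ∧ l p.2 ≤ p.1 ∧ p.1 ≤ r p.2} ⊆
      {p : ℝ × ℝ | p.2 ≤ t₁ ∧ l p.2 ≤ p.1 ∧ p.1 ≤ r p.2} := fun p hp => ⟨hp.1.2, hp.2⟩
  have hge : ∀ t ≤ t₁, ∀ x, l t ≤ x → x ≤ r t → Z x t ≤ (1 + η * (t₁ - t)) * Z x t := by
    intro t ht x h1 h2
    have := hpos t ht x h1 h2
    have : 0 ≤ η * (t₁ - t) * Z x t := by
      have : 0 ≤ t₁ - t := by linarith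
      positivity
    linarith
  have key := le_of_no_touching (t₀ := t₀) (t₁ := t₁) (U := U)
    (Z := fun x t => (1 + η * (t₁ - t)) * Z x t) hl hr (hU.mono hsub)
    ((Continuous.continuousOn (by fun_prop)).mul (hZ.mono hsub)) ?_ ?_ ?_ ?_ ?_ t₁
    ⟨by linarith, le_rfl⟩ x hx1 hx2
  · simpa using key
  · intro t ht x h1 h2
    exact (hpos t ht.2 x h1 h2).trans_le (hge t ht.2 x h1 h2)
  · intro x h1 h2
    have ht : t₀ ≤ t₁ := by linarith
    refine (hbdd t₀ ht x h1 h2).trans ?_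
    refine mul_le_mul_of_nonneg_right ?_ (hpos t₀ ht x h1 h2).le
    have : η * (t₁ - t₀) = |C| := by rw [ht0]; field_simp; ring
    rw [this]; linarith [le_abs_self C]
  · intro t ht h
    exact (hleft t ht.2 h).trans (hge t ht.2 _ le_rfl h)
  · intro t ht h
    exact (hright t ht.2 h).trans (hge t ht.2 _ h le_rfl)
  · intro t ht y h1 h2 k hk hUk
    have hZ0 := hpos t ht.2 y h1.le h2.le
    have h3 : 0 ≤ η * (t₁ - t) := mul_nonneg hη.le (by linarith [ht.2])
    obtain ⟨ut, ux, uxx, zt, zx, zxx, jU, jZ, himp⟩ :=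
      hstep t ht.2 y h1 h2 (k * (1 + η * (t₁ - t))) (by nlinarith) (by rw [hUk]; ring)
    have hd : HasDerivAt (fun t => 1 + η * (t₁ - t)) (-η) t := by
      have := (((hasDerivAt_id t).const_sub t₁).const_mul η).const_add 1
      exact this.congr_deriv (by ring)
    refine ⟨ut, ux, uxx, _, _, _, jU, (HasJet.of_time y hd).mul jZ, fun e1 e2 => ?_⟩
    have := himp (by rw [e1]; ring) (e2.trans_eq (by ring))
    have h4 : 0 ≤ η * k * (η * (t₁ - t)) * Z y t := by positivity
    nlinarith

theorem bounded_of_almostPeriodic {f : ℝ → ℝ} (hf : BohrAlmostPeriodic f) (hc : Continuous f) :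
    ∃ A, ∀ x, f x ≤ A := by
  obtain ⟨L, hL, h⟩ := hf 1 one_pos
  obtain ⟨A, hA⟩ := (isCompact_Icc (a := (0 : ℝ)) (b := L)).bddAbove_image hc.continuousOn
  refine ⟨A + 1, fun x => ?_⟩
  obtain ⟨s, hs, h1⟩ := h (-x)
  have h2 := abs_lt.1 (h1 x)
  have h3 : f (x + s) ≤ A := hA ⟨x + s, ⟨by linarith [hs.1], by linarith [hs.2]⟩, rfl⟩
  linarith

section steady

variable {g u : ℝ → ℝ}

theorem IsBddPosSteadyState.differentiable (h : IsBddPosSteadyState g u) : Differentiable ℝ u :=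
  h.1.differentiable (by norm_num)

theorem IsBddPosSteadyState.contDiff_deriv (h : IsBddPosSteadyState g u) :
    ContDiff ℝ 1 (deriv u) := by
  have h1 : ContDiff ℝ (1 + 1) u := by simpa [one_add_one_eq_two] using h.1
  exact (contDiff_succ_iff_deriv.1 h1).2.2

theorem IsBddPosSteadyState.continuous_coeff (h : IsBddPosSteadyState g u) : Continuous g := by
  have hc : Continuous (deriv (deriv u)) := h.contDiff_deriv.continuous_deriv (by norm_num)
  have e : g = fun x => u x - deriv (deriv u) x / u x := by
    ext x
    have := h.2.2.1 x
    have := h.2.2.2 x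
    field_simp
    linarith
  rw [e]
  exact h.differentiable.continuous.sub
    (hc.div h.differentiable.continuous fun x => (h.2.2.1 x).ne')

theorem IsBddPosSteadyState.hasJet (h : IsBddPosSteadyState g u) (x t : ℝ) :
    HasJet (fun x _ => u x) x t 0 (deriv u x) (-(u x * (g x - u x))) where
  dt := hasDerivAt_const _ _
  ev := Eventually.of_forall fun y => h.differentiable y
  dx := (h.differentiable x).hasDerivAt
  dxx := by
    have := ((h.contDiff_deriv.differentiable (by norm_num)) x).hasDerivAt
    exact this.congr_deriv (by linarith [h.2.2.2 x])

theorem IsBddPosSteadyState.lower_bound (h : IsBddPosSteadyState g u) {m : ℝ} (hm : 0 < m)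
    (hg : ∀ x, m ≤ g x) (x : ℝ) : m / 2 ≤ u x := by
  set w := Real.sqrt (m / 2) with hw
  have hw0 : 0 < w := Real.sqrt_pos.2 (by linarith)
  have hw2 : w * w = m / 2 := Real.mul_self_sqrt (by linarith)
  set R := Real.pi / (2 * w) with hR
  have hR0 : 0 < R := by positivity
  have hwR : w * R = Real.pi / 2 := by rw [hR]; field_simp
  have hucont : Continuous u := h.differentiable.continuous
  obtain ⟨b, -, hb⟩ := (isCompact_Icc (a := x - R) (b := x + R)).exists_isMinOn
    ⟨x, by constructor <;> linarith⟩ hucont.continuousOn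
  have hub := h.2.2.1 b
  have key := le_of_no_touching_ancient (l := fun _ => x - R) (r := fun _ => x + R) (t₁ := 0)
    (η := 1) (C := m / 2 / u b) (U := fun y _ => m / 2 * Real.cos (w * (y - x)))
    (Z := fun y _ => u y) continuous_const continuous_const one_pos
    (Continuous.continuousOn (by fun_prop)) (Continuous.continuousOn (by fun_prop))
    (fun _ _ y _ _ => h.2.2.1 y) ?_ ?_ ?_ ?_ x (by linarith) (by linarith)
  · simpa using key
  · intro t _ y h1 h2
    have h3 : u b ≤ u y := hb ⟨h1, h2⟩
    calc m / 2 * Real.cos (w * (y - x)) ≤ m / 2 * 1 := by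
          gcongr; exact Real.cos_le_one _
      _ = m / 2 / u b * u b := by field_simp
      _ ≤ m / 2 / u b * u y := by gcongr
  · intro t _ _
    have : w * (x - R - x) = -(Real.pi / 2) := by linarith
    simp only [this, Real.cos_neg, Real.cos_pi_div_two, mul_zero]
    exact (h.2.2.1 _).le
  · intro t _ _
    have : w * (x + R - x) = Real.pi / 2 := by linarith
    simp only [this, Real.cos_pi_div_two, mul_zero]
    exact (h.2.2.1 _).le
  · intro t _ y h1 h2 k hk hUk
    have hcd : ∀ y, HasDerivAt (fun y => m / 2 * Real.cos (w * y))
        (-(m / 2 * w * Real.sin (w * y))) y := by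
      intro y
      have := ((Real.hasDerivAt_cos (w * y)).comp y ((hasDerivAt_id y).const_mul w)).const_mul
        (m / 2)
      exact this.congr_deriv (by ring)
    have hcd' : ∀ y, HasDerivAt (fun y => -(m / 2 * w * Real.sin (w * y)))
        (-(m / 2 * (w * w) * Real.cos (w * y))) y := by
      intro y
      have := (((Real.hasDerivAt_sin (w * y)).comp y ((hasDerivAt_id y).const_mul w)).const_mul
        (m / 2 * w)).neg
      exact this.congr_deriv (by ring)
    refine ⟨_, _, _, _, _, _, HasJet.moving (h := fun _ => x) y hcd hcd'
      (hasDerivAt_const t x), h.hasJet y t, fun _ e2 => ?_⟩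
    exfalso
    have hu := h.2.2.1 y
    have h3 : u y < m / 2 := by
      have : m / 2 * Real.cos (w * (y - x)) ≤ m / 2 * 1 := by
        gcongr; exact Real.cos_le_one _
      nlinarith
    rw [hw2] at e2
    have h4 : k * u y * (g y - u y) ≤ m / 2 * (k * u y) := by
      have : m / 2 * (m / 2 * Real.cos (w * (y - x))) = m / 2 * (k * u y) := by rw [hUk]
      nlinarith
    have h5 : 0 < k * u y := by positivity
    have := hg y
    nlinarith

end steady

section wave

variable {μ : ℝ} {a ustar : ℝ → ℝ} {u : ℝ → ℝ → ℝ} {h : ℝ → ℝ}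

theorem IsAPSemiWave.hasDerivAt_front (W : IsAPSemiWave μ a ustar u h) (t : ℝ) :
    HasDerivAt h (deriv h t) t :=
  (W.sol.h_diff t (mem_univ t)).hasDerivAt

theorem IsAPSemiWave.continuous_front (W : IsAPSemiWave μ a ustar u h) : Continuous h :=
  continuous_iff_continuousAt.2 fun t => (W.hasDerivAt_front t).continuousAt

theorem IsAPSemiWave.deriv_front_nonneg (W : IsAPSemiWave μ a ustar u h) (t : ℝ) :
    0 ≤ deriv h t :=
  W.mono.monotone.deriv_nonneg

theorem IsAPSemiWave.hasJet (W : IsAPSemiWave μ a ustar u h) {x t : ℝ} (hx : x < h t) :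
    HasJet u x t (deriv (fun s => u x s) t) (deriv (fun y => u y t) x)
      (deriv (deriv fun y => u y t) x) where
  dt := (W.sol.u_reg_t t (mem_univ t) x hx).hasDerivAt
  ev := by
    filter_upwards [Iio_mem_nhds hx] with y hy using (W.sol.u_reg_x t (mem_univ t) y hy).1
  dx := (W.sol.u_reg_x t (mem_univ t) x hx).1.hasDerivAt
  dxx := (W.sol.u_reg_x t (mem_univ t) x hx).2.hasDerivAt

theorem IsAPSemiWave.pde (W : IsAPSemiWave μ a ustar u h) {x t : ℝ} (hx : x < h t) :
    deriv (fun s => u x s) t = deriv (deriv fun y => u y t) x + u x t * (a x - u x t) :=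
  W.sol.pde t (mem_univ t) x hx

theorem IsAPSemiWave.nonneg (W : IsAPSemiWave μ a ustar u h) {x t : ℝ} (hx : x ≤ h t) :
    0 ≤ u x t := by
  rcases hx.lt_or_eq with h1 | h1
  · exact (W.pos t x h1).le
  · rw [h1, W.sol.bdry t (mem_univ t)]

theorem IsAPSemiWave.continuousOn (W : IsAPSemiWave μ a ustar u h) {s : Set (ℝ × ℝ)}
    (hs : ∀ p ∈ s, p.1 ≤ h p.2) : ContinuousOn (fun p : ℝ × ℝ => u p.1 p.2) s :=
  W.sol.u_cont.mono fun p hp => ⟨mem_univ _, hs p hp⟩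

theorem IsAPSemiWave.far_field (W : IsAPSemiWave μ a ustar u h) {ε : ℝ} (hε : 0 < ε) :
    ∃ X < 0, ∀ t, ∀ x ≤ h t + X, |u x t - ustar x| < ε := by
  obtain ⟨X, hX⟩ := W.connects ε hε
  refine ⟨min X (-1), by simp, fun t x hx => ?_⟩
  have h1 := hX (x - h t) (by linarith [min_le_left X (-1)]) (h t)
  simpa [profile, Function.leftInverse_invFun W.mono.injective t] using h1

theorem IsAPSemiWave.upper_barrier (W : IsAPSemiWave μ a ustar u h) {A : ℝ}
    (hA : ∀ x, a x ≤ A) :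
    ∃ M > 0, ∀ t, ∀ x ≤ h t, u x t ≤ M ∧ u x t ≤ M * (h t - x) := by
  obtain ⟨C, hC⟩ := W.bdd
  have hC' : ∀ x t, u x t ≤ |C| := fun x t => (le_abs_self _).trans ((hC x t).trans (le_abs_self C))
  set M := |C| * |A| + |C| + 1 with hM
  have hM0 : 0 < M := by positivity
  have hMC : |C| ≤ M := by have : 0 ≤ |C| * |A| := by positivity
                           linarith
  have strip : ∀ t x, h t - 1 ≤ x → x ≤ h t → u x t ≤ M * (1 - (1 + (x - h t)) ^ 2) := by
    intro t₁ x₁ hx1 hx2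
    refine le_of_forall_pos_le_add fun ε hε => ?_
    have hpsi : ∀ y, HasDerivAt (fun y : ℝ => M * (1 - (1 + y) ^ 2) + ε)
        (-(2 * M * (1 + y))) y := by
      intro y
      have := ((((hasDerivAt_id y).const_add 1).pow 2).const_sub 1).const_mul M |>.add_const ε
      refine this.congr_deriv ?_
      simp; ring
    have hpsi' : ∀ y, HasDerivAt (fun y : ℝ => -(2 * M * (1 + y))) (-(2 * M)) y := by
      intro y
      have := (((hasDerivAt_id y).const_add 1).const_mul (2 * M)).neg
      exact this.congr_deriv (by ring)
    have hpos : ∀ t x, h t - 1 ≤ x → x ≤ h t →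
        ε ≤ M * (1 - (1 + (x - h t)) ^ 2) + ε := by
      intro t x h1 h2
      have : 0 ≤ 1 - (1 + (x - h t)) ^ 2 := by nlinarith
      have := mul_nonneg hM0.le this
      linarith
    have key := le_of_no_touching_ancient (l := fun t => h t - 1) (r := h) (t₁ := t₁)
      (η := M / (2 * (M + ε))) (C := |C| / ε) (U := u)
      (Z := fun x t => M * (1 - (1 + (x - h t)) ^ 2) + ε)
      (W.continuous_front.sub continuous_const) W.continuous_front (by positivity)
      (W.continuousOn fun p hp => hp.2.2)
      (Continuous.continuousOn (by
        have := W.continuous_front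
        fun_prop)) ?_ ?_ ?_ ?_ ?_ x₁ hx1 hx2
    · exact key
    · intro t _ x h1 h2
      exact hε.trans_le (hpos t x h1 h2)
    · intro t _ x h1 h2
      calc u x t ≤ |C| := hC' x t
        _ = |C| / ε * ε := by field_simp
        _ ≤ _ := by gcongr; exact hpos t x h1 h2
    · intro t _ _
      have := hC' (h t - 1) t
      have e : M * (1 - (1 + (h t - 1 - h t)) ^ 2) + ε = M + ε := by ring
      linarith
    · intro t _ _
      rw [W.sol.bdry t (mem_univ t)]
      ring_nf
      positivity
    · intro t _ x h1 h2 k hk hUk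
      refine ⟨_, _, _, _, _, _, W.hasJet h2, HasJet.moving x hpsi hpsi' (W.hasDerivAt_front t),
        fun _ e2 => ?_⟩
      rw [W.pde h2]
      have hh := W.deriv_front_nonneg t
      have hu0 := (W.pos t x h2).le
      have h3 : u x t * (a x - u x t) ≤ |C| * |A| := by
        have h4 : a x - u x t ≤ |A| := by linarith [hA x, le_abs_self A]
        calc u x t * (a x - u x t) ≤ u x t * |A| := by gcongr
          _ ≤ |C| * |A| := by gcongr; exact hC' x t
      have h5 : M * (1 - (1 + (x - h t)) ^ 2) + ε ≤ M + ε := by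
        have : 0 ≤ M * (1 + (x - h t)) ^ 2 := by positivity
        linarith
      have h6 : M / (2 * (M + ε)) * k * (M * (1 - (1 + (x - h t)) ^ 2) + ε) ≤ k * (M / 2) := by
        calc _ ≤ M / (2 * (M + ε)) * k * (M + ε) := by gcongr
          _ = k * (M / 2) := by field_simp
      have h7 : 0 ≤ k * (deriv h t * (2 * M * (1 + (x - h t)))) := by
        have : 0 ≤ 1 + (x - h t) := by linarith
        positivity
      have h8 : |C| * |A| < M := by have := abs_nonneg C; linarith
      nlinarith
  refine ⟨2 * M, by positivity, fun t x hx => ⟨by linarith [hC' x t], ?_⟩⟩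
  rcases le_total (h t - 1) x with h1 | h1
  · have := strip t x h1 hx
    nlinarith [sq_nonneg (x - h t)]
  · have := hC' x t
    nlinarith

/-- A linear upper bound at the front bounds its speed. -/
theorem IsAPSemiWave.front_speed_le (W : IsAPSemiWave μ a ustar u h) (hμ : 0 < μ) {M : ℝ}
    (hM : 0 < M) (hu : ∀ t, ∀ x ≤ h t, u x t ≤ M * (h t - x)) (t : ℝ) : deriv h t ≤ μ * M := by
  have hst := W.sol.stefan t (mem_univ t)
  by_cases hd : DifferentiableAt ℝ (fun y => u y t) (h t)
  · have h1 : 0 ≤ deriv (fun y => u y t) (h t) + M := by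
      have h2 : HasDerivAt (fun y => u y t + M * (y - h t))
          (deriv (fun y => u y t) (h t) + M) (h t) := by
        have := hd.hasDerivAt.add (((hasDerivAt_id (h t)).sub_const (h t)).const_mul M)
        exact this.congr_deriv (by ring)
      refine deriv_nonneg_of_left_max h2 ?_
      filter_upwards [self_mem_nhdsWithin] with y hy
      have := hu t y (le_of_lt hy)
      rw [W.sol.bdry t (mem_univ t)]
      linarith
    rw [hst]; nlinarith
  · rw [hst, deriv_zero_of_not_differentiableAt hd]; simp; positivity

theorem IsAPSemiWave.lower_barrier (W : IsAPSemiWave μ a ustar u h) {m K : ℝ} (hm : 0 < m)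
    (ham : ∀ x, m ≤ a x) (hstar : ∀ x, m / 2 ≤ ustar x) (hK : ∀ t, deriv h t ≤ K)
    (hK0 : 0 < K) :
    ∃ c > 0, ∀ t, ∀ x ≤ h t, c * min (h t - x) 1 ≤ u x t := by
  obtain ⟨X, hX0, hX⟩ := W.far_field (show 0 < m / 4 by linarith)
  have hleft : ∀ t, ∀ x ≤ h t + X, m / 4 ≤ u x t := fun t x hx => by
    linarith [(abs_lt.1 (hX t x hx)).1, hstar x]
  set B := K + 1 with hB
  set E := Real.exp (-B * X) with hE
  have hE1 : 0 < E := Real.exp_pos _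
  set c := min (m / 4 / E) (m / 4) with hc
  have hc0 : 0 < c := by positivity
  have hcE : c * E ≤ m / 4 := by
    calc c * E ≤ m / 4 / E * E := by gcongr; exact min_le_left _ _
      _ = m / 4 := by field_simp
  have strip : ∀ t x, h t + X ≤ x → x ≤ h t → c * (Real.exp (-B * (x - h t)) - 1) ≤ u x t := by
    intro t₁ x₁ hx1 hx2
    have hphi : ∀ y, HasDerivAt (fun y : ℝ => c * (Real.exp (-B * y) - 1))
        (-(c * B * Real.exp (-B * y))) y := by
      intro y
      have := ((((hasDerivAt_id y).const_mul (-B)).exp).sub_const 1).const_mul c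
      refine this.congr_deriv ?_
      simp; ring
    have hphi' : ∀ y, HasDerivAt (fun y : ℝ => -(c * B * Real.exp (-B * y)))
        (c * B ^ 2 * Real.exp (-B * y)) y := by
      intro y
      have := ((((hasDerivAt_id y).const_mul (-B)).exp).const_mul (c * B)).neg
      refine this.congr_deriv ?_
      simp; ring
    have hEle : ∀ t x, h t + X ≤ x → Real.exp (-B * (x - h t)) ≤ E := by
      intro t x hx
      apply Real.exp_le_exp.2
      have : 0 < B := by linarith
      nlinarith
    have key := le_of_no_touching_ancient (l := fun t => h t + X) (r := h) (t₁ := t₁)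
      (η := c * B / (2 * (1 + m / 4))) (C := 1 + m / 4)
      (U := fun x t => 1 + (c * (Real.exp (-B * (x - h t)) - 1) - u x t))
      (Z := fun x t => 1)
      (W.continuous_front.add continuous_const) W.continuous_front (by positivity)
      (ContinuousOn.add continuousOn_const (ContinuousOn.sub (Continuous.continuousOn (by
        have := W.continuous_front
        fun_prop)) (W.continuousOn fun p hp => hp.2.2)))
      continuousOn_const ?_ ?_ ?_ ?_ ?_ x₁ hx1 hx2
    · linarith
    · intros; exact one_pos
    · intro t _ x h1 h2
      have := W.nonneg h2
      have := mul_le_mul_of_nonneg_left (hEle t x h1) hc0.le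
      linarith
    · intro t _ _
      have := hleft t (h t + X) le_rfl
      have := mul_le_mul_of_nonneg_left (hEle t (h t + X) le_rfl) hc0.le
      linarith
    · intro t _ _
      simp [W.sol.bdry t (mem_univ t)]
    · intro t _ x h1 h2 k hk hUk
      refine ⟨_, _, _, _, _, _, (HasJet.const 1 x t).add
        ((HasJet.moving x hphi hphi' (W.hasDerivAt_front t)).sub (W.hasJet h2)),
        HasJet.const 1 x t, fun _ e2 => ?_⟩
      rw [W.pde h2]
      have hu0 := W.pos t x h2
      have h3 := mul_le_mul_of_nonneg_left (hEle t x h1.le) hc0.le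
      have h4 : 1 ≤ Real.exp (-B * (x - h t)) := by
        apply Real.one_le_exp
        have : 0 < B := by linarith
        nlinarith
      have h5 : 0 ≤ u x t * (a x - u x t) := by
        apply mul_nonneg hu0.le
        linarith [ham x]
      have h6 : k ≤ 1 + m / 4 := by linarith
      have h7 : c * B / (2 * (1 + m / 4)) * k * 1 ≤ c * B / 2 := by
        calc c * B / (2 * (1 + m / 4)) * k * 1 ≤ c * B / (2 * (1 + m / 4)) * (1 + m / 4) * 1 := by
              gcongr
          _ = c * B / 2 := by field_simp
      have h8 : c * B * 1 ≤ c * B * Real.exp (-B * (x - h t)) * (B - deriv h t) := by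
        have h9 : 1 ≤ B - deriv h t := by linarith [hK t]
        have h10 : c * B ≤ c * B * Real.exp (-B * (x - h t)) :=
          le_mul_of_one_le_right (by positivity) h4
        have h11 : 0 < c * B := by positivity
        nlinarith
      have h12 : 0 < c * B := by positivity
      nlinarith
  have hXs : 0 < -X := by linarith
  refine ⟨c * min 1 (-X), by positivity, fun t x hx => ?_⟩
  have hmin0 : 0 ≤ min (h t - x) 1 := le_min (by linarith) zero_le_one
  rcases le_total (h t + X) x with h1 | h1
  · have h2 := strip t x h1 hx
    have h3 := Real.add_one_le_exp (-B * (x - h t))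
    have h4 : h t - x ≤ -B * (x - h t) := by nlinarith
    calc c * min 1 (-X) * min (h t - x) 1 ≤ c * 1 * (h t - x) := by
          gcongr
          · exact min_le_left _ _
          · exact min_le_left _ _
      _ ≤ c * (Real.exp (-B * (x - h t)) - 1) := by
          rw [mul_one]; exact mul_le_mul_of_nonneg_left (by linarith) hc0.le
      _ ≤ u x t := h2
  · calc c * min 1 (-X) * min (h t - x) 1 ≤ m / 4 * 1 * 1 := by
          gcongr
          · exact min_le_right _ _
          · exact min_le_left _ _
          · exact min_le_right _ _
      _ ≤ u x t := by linarith [hleft t x h1]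

theorem IsAPSemiWave.deriv_at_front_le (W : IsAPSemiWave μ a ustar u h) {c t : ℝ}
    (hu : ∀ x ≤ h t, c * min (h t - x) 1 ≤ u x t)
    (hd : DifferentiableAt ℝ (fun y => u y t) (h t)) :
    deriv (fun y => u y t) (h t) ≤ -c := by
  have h2 : HasDerivAt (fun y => -u y t - c * (y - h t))
      (-deriv (fun y => u y t) (h t) - c) (h t) := by
    have := hd.hasDerivAt.neg.sub (((hasDerivAt_id (h t)).sub_const (h t)).const_mul c)
    exact this.congr_deriv (by ring)
  have := deriv_nonneg_of_left_max h2 (by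
    filter_upwards [self_mem_nhdsWithin, nhdsWithin_le_nhds (lt_mem_nhds (show h t - 1 < h t by
      linarith))] with y hy hy1
    have h3 := hu y (le_of_lt hy)
    rw [min_eq_left (by linarith)] at h3
    rw [W.sol.bdry t (mem_univ t)]
    linarith)
  linarith

/-- A linear lower bound at the front forces the Stefan condition to hold with a genuine
derivative and a uniformly positive speed. -/
theorem IsAPSemiWave.front_speed_ge (W : IsAPSemiWave μ a ustar u h) (hμ : 0 < μ) {c : ℝ}
    (hc : 0 < c) (hu : ∀ t, ∀ x ≤ h t, c * min (h t - x) 1 ≤ u x t) (t : ℝ) :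
    μ * c ≤ deriv h t := by
  have hdich : ∀ t, deriv h t = 0 ∨ μ * c ≤ deriv h t := by
    intro t
    have hst := W.sol.stefan t (mem_univ t)
    by_cases hd : DifferentiableAt ℝ (fun y => u y t) (h t)
    · right
      have := W.deriv_at_front_le (hu t) hd
      rw [hst]; nlinarith
    · left
      rw [hst, deriv_zero_of_not_differentiableAt hd, mul_zero]
  have hcont : Continuous (deriv h) := continuousOn_univ.1 W.sol.h_deriv_cont
  have hmc : 0 < μ * c := by positivity
  rcases hdich t with h0 | h1
  · exfalso
    have hall : ∀ s, deriv h s = 0 := by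
      intro s
      by_contra hs
      have hs' : μ * c ≤ deriv h s := (hdich s).resolve_left hs
      obtain ⟨r, hr⟩ := mem_range_of_exists_le_of_exists_ge hcont (c := μ * c / 2)
        ⟨t, by rw [h0]; positivity⟩ ⟨s, by linarith⟩
      rcases hdich r with h2 | h2 <;> linarith
    have := is_const_of_deriv_eq_zero (fun t => W.sol.h_diff t (mem_univ t)) hall 0 1
    exact absurd this (W.mono zero_lt_one).ne
  · exact h1

/-- Uniform two-sided bounds for a semi-wave near and behind its front. -/
structure FrontBounds (u : ℝ → ℝ → ℝ) (h : ℝ → ℝ) (M K c : ℝ) : Prop where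
  hM : 0 < M
  hK : 0 < K
  hc : 0 < c
  le : ∀ t, ∀ x ≤ h t, u x t ≤ M
  le_lin : ∀ t, ∀ x ≤ h t, u x t ≤ M * (h t - x)
  ge : ∀ t, ∀ x ≤ h t, c * min (h t - x) 1 ≤ u x t
  speed_le : ∀ t, deriv h t ≤ K
  speed_ge : ∀ t, c ≤ deriv h t

theorem IsAPSemiWave.frontBounds (W : IsAPSemiWave μ a ustar u h) (hμ : 0 < μ) {m A : ℝ}
    (hm : 0 < m) (ham : ∀ x, m ≤ a x) (hA : ∀ x, a x ≤ A) (hstar : ∀ x, m / 2 ≤ ustar x) :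
    ∃ M K c, FrontBounds u h M K c := by
  obtain ⟨M, hM, hu⟩ := W.upper_barrier hA
  have hK := W.front_speed_le hμ hM fun t x hx => (hu t x hx).2
  obtain ⟨c, hc, hcu⟩ := W.lower_barrier hm ham hstar hK (by positivity)
  have hs := W.front_speed_ge hμ hc hcu
  refine ⟨M, μ * M, min c (μ * c), hM, by positivity, by positivity,
    fun t x hx => (hu t x hx).1, fun t x hx => (hu t x hx).2, fun t x hx => ?_, hK,
    fun t => (min_le_right _ _).trans (hs t)⟩
  refine le_trans ?_ (hcu t x hx)
  have : 0 ≤ min (h t - x) 1 := le_min (by linarith) zero_le_one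
  gcongr
  exact min_le_left _ _

theorem FrontBounds.front_sub_le {M K c : ℝ} (F : FrontBounds u h M K c)
    (hd : Differentiable ℝ h) {s t : ℝ} (hst : s ≤ t) : h t - h s ≤ K * (t - s) :=
  image_sub_le_mul_sub_of_deriv_le hd F.speed_le hst

theorem FrontBounds.le_front_sub {M K c : ℝ} (F : FrontBounds u h M K c)
    (hd : Differentiable ℝ h) {s t : ℝ} (hst : s ≤ t) : c * (t - s) ≤ h t - h s :=
  mul_sub_le_image_sub_of_le_deriv hd F.speed_ge hst

theorem IsAPSemiWave.differentiable_front (W : IsAPSemiWave μ a ustar u h) :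
    Differentiable ℝ h := fun t => W.sol.h_diff t (mem_univ t)

theorem IsAPSemiWave.hasDerivAt_at_front (W : IsAPSemiWave μ a ustar u h) {M K c : ℝ}
    (F : FrontBounds u h M K c) (t : ℝ) :
    HasDerivAt (fun y => u y t) (deriv (fun y => u y t) (h t)) (h t) := by
  refine DifferentiableAt.hasDerivAt ?_
  by_contra hd
  have := W.sol.stefan t (mem_univ t)
  rw [deriv_zero_of_not_differentiableAt hd, mul_zero] at this
  have := F.speed_ge t
  linarith [F.hc]

end wave

section ordering

variable {μ : ℝ} {a ustar : ℝ → ℝ} {u₁ u₂ : ℝ → ℝ → ℝ} {h₁ h₂ : ℝ → ℝ}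

theorem IsAPSemiWave.far_ratio (W₁ : IsAPSemiWave μ a ustar u₁ h₁)
    (W₂ : IsAPSemiWave μ a ustar u₂ h₂) {m : ℝ} (hm : 0 < m) (hstar : ∀ x, m / 2 ≤ ustar x)
    {ε : ℝ} (hε : 0 < ε) :
    ∃ X < 0, ∀ t₁ t₂, ∀ x ≤ h₁ t₁ + X, x ≤ h₂ t₂ + X → u₁ x t₁ ≤ (1 + ε) * u₂ x t₂ := by
  have hd : 0 < ε * m / (2 * (2 + ε)) := by positivity
  obtain ⟨X₁, hX₁, h1⟩ := W₁.far_field hd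
  obtain ⟨X₂, hX₂, h2⟩ := W₂.far_field hd
  refine ⟨min X₁ X₂, by simp [hX₁], fun t₁ t₂ x hx1 hx2 => ?_⟩
  have e1 := (abs_lt.1 (h1 t₁ x (by linarith [min_le_left X₁ X₂]))).2
  have e2 := (abs_lt.1 (h2 t₂ x (by linarith [min_le_right X₁ X₂]))).1
  have e3 := hstar x
  have e4 : ε * m / (2 * (2 + ε)) * (2 + ε) = ε * (m / 2) := by field_simp
  nlinarith

/-- If the front of `u₁` stays uniformly behind the front of a time translate of `u₂` in the
past, then `u₁` lies below that translate. -/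
theorem IsAPSemiWave.le_of_front_gap (W₁ : IsAPSemiWave μ a ustar u₁ h₁)
    (W₂ : IsAPSemiWave μ a ustar u₂ h₂) {m M₁ K₁ c₁ M₂ K₂ c₂ : ℝ} (hm : 0 < m)
    (hstar : ∀ x, m / 2 ≤ ustar x) (F₁ : FrontBounds u₁ h₁ M₁ K₁ c₁)
    (F₂ : FrontBounds u₂ h₂ M₂ K₂ c₂) {s d t₁ : ℝ} (hd : 0 < d)
    (hgap : ∀ t ≤ t₁, h₁ t + d ≤ h₂ (t + s)) : ∀ x ≤ h₁ t₁, u₁ x t₁ ≤ u₂ x (t₁ + s) := by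
  intro x₁ hx₁
  set b := c₂ * min d 1 with hb
  have hb0 : 0 < b := by have := F₂.hc; positivity
  have hbu : ∀ t ≤ t₁, ∀ x ≤ h₁ t, b ≤ u₂ x (t + s) := by
    intro t ht x hx
    have h1 := hgap t ht
    refine le_trans ?_ (F₂.ge (t + s) x (by linarith))
    have := F₂.hc
    rw [hb]; gcongr; linarith
  have hlim : ∀ ε > 0, u₁ x₁ t₁ ≤ (1 + ε) * u₂ x₁ (t₁ + s) := by
    intro ε hε
    obtain ⟨X, hX0, hX⟩ := W₁.far_ratio W₂ hm hstar hε
    have hXt : ∀ t ≤ t₁, ∀ x ≤ h₁ t + X, u₁ x t ≤ (1 + ε) * u₂ x (t + s) :=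
      fun t ht x hx => hX t (t + s) x hx (by linarith [hgap t ht])
    rcases le_total x₁ (h₁ t₁ + X) with hc | hc
    · exact hXt t₁ le_rfl x₁ hc
    refine le_of_no_touching_ancient (l := fun t => h₁ t + X) (r := h₁) (t₁ := t₁)
      (η := ε * b / 2) (C := M₁ / b) (U := u₁) (Z := fun x t => (1 + ε) * u₂ x (t + s))
      (W₁.continuous_front.add continuous_const) W₁.continuous_front (by positivity)
      (W₁.continuousOn fun p hp => hp.2.2) ?_ ?_ ?_ ?_ ?_ ?_ x₁ hc hx₁
    · refine continuousOn_const.mul ?_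
      have := W₂.continuousOn (s := {p | p.1 ≤ h₂ p.2}) fun p hp => hp
      refine this.comp (f := fun p : ℝ × ℝ => (p.1, p.2 + s))
        (Continuous.continuousOn (by fun_prop)) ?_
      rintro ⟨x, t⟩ ⟨ht, -, hx⟩
      change x ≤ h₂ (t + s)
      linarith [hgap t ht, show x ≤ h₁ t from hx]
    · intro t ht x _ hx
      have : 0 < u₂ x (t + s) := hb0.trans_le (hbu t ht x hx)
      positivity
    · intro t ht x _ hx
      have h1 := hbu t ht x hx
      have hM := F₁.hM
      calc u₁ x t ≤ M₁ := F₁.le t x hx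
        _ = M₁ / b * (1 * b) := by field_simp
        _ ≤ M₁ / b * ((1 + ε) * u₂ x (t + s)) := by gcongr; linarith
    · intro t ht _
      exact hXt t ht _ le_rfl
    · intro t ht _
      rw [W₁.sol.bdry t (mem_univ t)]
      have : 0 < u₂ (h₁ t) (t + s) := hb0.trans_le (hbu t ht (h₁ t) le_rfl)
      positivity
    · intro t ht x _ hx k hk hUk
      have h1 := hbu t ht x hx.le
      have hx2 : x < h₂ (t + s) := by linarith [hgap t ht]
      have hθ : HasDerivAt (fun t => t + s) 1 t := (hasDerivAt_id' t).add_const s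
      refine ⟨_, _, _, _, _, _, W₁.hasJet hx, (HasJet.reparam (θ := fun t => t + s)
        (W₂.hasJet hx2) hθ).const_mul (1 + ε), fun _ e2 => ?_⟩
      rw [W₁.pde hx, W₂.pde hx2, hUk]
      set v := u₂ x (t + s)
      set vxx := deriv (deriv fun y => u₂ y (t + s)) x
      have hv : 0 < v := by linarith
      have hκ : 1 + ε ≤ k * (1 + ε) := by nlinarith
      set κ := k * (1 + ε) with hκd
      have e3 : b * ε ≤ v * (κ - 1) := by
        apply mul_le_mul h1 (by linarith) hε.le hv.le
      have e4 : 0 < κ * v := by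
        have : 0 < κ := by linarith
        positivity
      have e5 : κ * v * (ε * b / 2) < κ * v * (v * (κ - 1)) := by
        apply mul_lt_mul_of_pos_left _ e4
        have : 0 < ε * b := by positivity
        linarith
      have e6 : k * ((1 + ε) * v) = κ * v := by rw [hκd]; ring
      have e7 : k * ((1 + ε) * (1 * (vxx + v * (a x - v)))) = κ * vxx + κ * v * (a x - v) := by
        rw [hκd]; ring
      have e8 : k * ((1 + ε) * vxx) = κ * vxx := by rw [hκd]; ring
      have e9 : ε * b / 2 * k * ((1 + ε) * v) = κ * v * (ε * b / 2) := by rw [hκd]; ring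
      rw [e6, e7, e9]
      rw [e8] at e2
      nlinarith
  have hv : 0 < u₂ x₁ (t₁ + s) := hb0.trans_le (hbu t₁ le_rfl x₁ hx₁)
  refine le_of_forall_pos_le_add fun ε hε => ?_
  have h1 := hlim (ε / u₂ x₁ (t₁ + s)) (by positivity)
  have : (1 + ε / u₂ x₁ (t₁ + s)) * u₂ x₁ (t₁ + s) = u₂ x₁ (t₁ + s) + ε := by field_simp
  linarith

theorem IsAPSemiWave.tendsto_time {u : ℝ → ℝ → ℝ} {h : ℝ → ℝ} (W : IsAPSemiWave μ a ustar u h)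
    {x t : ℝ} (hx : x ≤ h t) : Tendsto (fun σ => u x (t + σ)) (𝓝[>] 0) (𝓝 (u x t)) := by
  have h1 := (W.continuousOn (s := {p | p.1 ≤ h p.2}) fun p hp => hp) (x, t) hx
  have h2 : Tendsto (fun σ : ℝ => (x, t + σ)) (𝓝[>] 0) (𝓝[{p | p.1 ≤ h p.2}] (x, t)) := by
    refine tendsto_nhdsWithin_iff.2 ⟨?_, ?_⟩
    · have : Continuous fun σ : ℝ => (x, t + σ) := by fun_prop
      have := this.tendsto 0
      simp only [add_zero] at this
      exact this.mono_left nhdsWithin_le_nhds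
    · filter_upwards [self_mem_nhdsWithin] with σ hσ
      exact hx.trans (W.mono.monotone (by simp at hσ; linarith))
  exact h1.tendsto.comp h2

theorem IsAPSemiWave.le_of_front_le (W₁ : IsAPSemiWave μ a ustar u₁ h₁)
    (W₂ : IsAPSemiWave μ a ustar u₂ h₂) {m M₁ K₁ c₁ M₂ K₂ c₂ : ℝ} (hm : 0 < m)
    (hstar : ∀ x, m / 2 ≤ ustar x) (F₁ : FrontBounds u₁ h₁ M₁ K₁ c₁)
    (F₂ : FrontBounds u₂ h₂ M₂ K₂ c₂) {s t₁ : ℝ}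
    (hle : ∀ t ≤ t₁, h₁ t ≤ h₂ (t + s)) : ∀ x ≤ h₁ t₁, u₁ x t₁ ≤ u₂ x (t₁ + s) := by
  intro x hx
  refine ge_of_tendsto (W₂.tendsto_time (hx.trans (hle t₁ le_rfl))) ?_
  filter_upwards [self_mem_nhdsWithin] with σ hσ
  have hσ' : 0 < σ := hσ
  have := W₁.le_of_front_gap W₂ hm hstar F₁ F₂ (s := s + σ) (d := c₂ * σ) (t₁ := t₁)
    (mul_pos F₂.hc hσ') (fun t ht => ?_) x hx
  · rwa [add_assoc]
  · have h1 := F₂.le_front_sub W₂.differentiable_front (s := t + s) (t := t + (s + σ))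
      (by linarith)
    have : c₂ * (t + (s + σ) - (t + s)) = c₂ * σ := by ring
    linarith [hle t ht]

end ordering

section gradient

variable {μ : ℝ} {a ustar : ℝ → ℝ} {u : ℝ → ℝ → ℝ} {h : ℝ → ℝ}

theorem IsAPSemiWave.mono_time (W : IsAPSemiWave μ a ustar u h) {m M K c : ℝ} (hm : 0 < m)
    (hstar : ∀ x, m / 2 ≤ ustar x) (F : FrontBounds u h M K c) {x s t : ℝ} (hx : x ≤ h s)
    (hst : s ≤ t) : u x s ≤ u x t := by
  have := W.le_of_front_le W hm hstar F F (s := t - s) (t₁ := s)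
    (fun τ _ => W.mono.monotone (by linarith)) x hx
  simpa using this

theorem IsAPSemiWave.deriv_time_nonneg (W : IsAPSemiWave μ a ustar u h) {m M K c : ℝ}
    (hm : 0 < m) (hstar : ∀ x, m / 2 ≤ ustar x) (F : FrontBounds u h M K c) {x t : ℝ}
    (hx : x < h t) : 0 ≤ deriv (fun s => u x s) t := by
  refine deriv_nonneg_of_left_max (W.hasJet hx).dt ?_
  filter_upwards [nhdsWithin_le_nhds (continuousAt_const.eventually_lt
    W.continuous_front.continuousAt hx), self_mem_nhdsWithin] with s hs hst
  exact W.mono_time hm hstar F (le_of_lt hs) (le_of_lt hst)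

/-- Gradient bounds: `u_x` is bounded, and negative near the front. -/
theorem IsAPSemiWave.gradient_bounds (W : IsAPSemiWave μ a ustar u h) {m A M K c : ℝ}
    (hm : 0 < m) (ham : ∀ x, m ≤ a x) (hA : ∀ x, a x ≤ A) (hstar : ∀ x, m / 2 ≤ ustar x)
    (F : FrontBounds u h M K c) :
    ∃ G > 0, ∀ t, ∀ x < h t, |deriv (fun y => u y t) x| ≤ G ∧
      (h t - 1 ≤ x → deriv (fun y => u y t) x ≤ -c + G * (h t - x)) := by
  have hA0 : 0 < A := by linarith [ham 0, hA 0]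
  have hM := F.hM
  set C := M * A with hC
  have hC0 : 0 < C := by positivity
  have hxx : ∀ t, ∀ x < h t, -C ≤ deriv (deriv fun y => u y t) x := by
    intro t x hx
    have h1 := W.deriv_time_nonneg hm hstar F hx
    rw [W.pde hx] at h1
    have h2 := W.pos t x hx
    have : u x t * (a x - u x t) ≤ M * A := by
      calc u x t * (a x - u x t) ≤ u x t * A := by gcongr; linarith [hA x]
        _ ≤ M * A := by gcongr; exact F.le t x hx.le
    linarith
  have hmono : ∀ t x z, x ≤ z → z < h t →
      deriv (fun y => u y t) x - C * (z - x) ≤ deriv (fun y => u y t) z := by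
    intro t x z hxz hz
    have := (convex_Iio (h t)).mul_sub_le_image_sub_of_le_deriv (C := -C)
      (f := deriv fun y => u y t)
      (fun y hy => (W.sol.u_reg_x t (mem_univ t) y hy).2.continuousAt.continuousWithinAt)
      (fun y hy => by
        rw [interior_Iio] at hy
        exact (W.sol.u_reg_x t (mem_univ t) y hy).2.differentiableWithinAt)
      (fun y hy => by rw [interior_Iio] at hy; exact hxx t y hy)
      x (hxz.trans_lt hz) z hz hxz
    linarith
  have hmvt : ∀ t x z, x < z → z ≤ h t → ∃ y ∈ Ioo x z,
      deriv (fun y => u y t) y * (z - x) = u z t - u x t := by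
    intro t x z hxz hz
    obtain ⟨y, hy, he⟩ := exists_deriv_eq_slope (fun y => u y t) hxz
      (by
        have := W.continuousOn (s := {p | p.1 ≤ h p.2}) fun p hp => hp
        exact this.comp (f := fun y : ℝ => (y, t)) (Continuous.continuousOn (by fun_prop))
          fun y hy => hy.2.trans hz)
      (fun y hy => (W.sol.u_reg_x t (mem_univ t) y
        (hy.2.trans_le hz)).1.differentiableWithinAt)
    refine ⟨y, hy, ?_⟩
    rw [he]
    have : z - x ≠ 0 := by linarith
    field_simp
  have hup : ∀ t x z, x < z → z ≤ h t →
      (deriv (fun y => u y t) x - C * (z - x)) * (z - x) ≤ u z t - u x t := by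
    intro t x z hxz hz
    obtain ⟨y, hy, he⟩ := hmvt t x z hxz hz
    rw [← he]
    have := hmono t x y hy.1.le (hy.2.trans_le hz)
    have h2 : C * (y - x) ≤ C * (z - x) := by gcongr; exact hy.2.le
    exact mul_le_mul_of_nonneg_right (by linarith) (by linarith)
  have hlow : ∀ t, ∀ x < h t, -M ≤ deriv (fun y => u y t) x + C := by
    intro t x hx
    obtain ⟨y, hy, he⟩ := hmvt t (x - 1) x (by linarith) hx.le
    have h1 := hmono t y x hy.2.le hx
    have h2 : C * (x - y) ≤ C * 1 := by gcongr; linarith [hy.1]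
    have h3 := W.pos t x hx
    have h4 := F.le t (x - 1) (by linarith)
    linarith
  have hnear : ∀ t, ∀ x < h t, h t - 1 ≤ x →
      deriv (fun y => u y t) x ≤ -c + C * (h t - x) := by
    intro t x hx hx1
    have h1 := hup t x (h t) hx le_rfl
    rw [W.sol.bdry t (mem_univ t)] at h1
    have h2 := F.ge t x hx.le
    rw [min_eq_left (by linarith)] at h2
    have h3 : (deriv (fun y => u y t) x - C * (h t - x) + c) * (h t - x) ≤ 0 := by linarith
    have h4 := nonpos_of_mul_nonpos_left h3 (by linarith)
    linarith
  refine ⟨M + C, by positivity, fun t x hx => ⟨abs_le.2 ⟨by linarith [hlow t x hx], ?_⟩, ?_⟩⟩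
  · rcases le_total (h t - 1) x with h1 | h1
    · have := hnear t x hx h1
      have h2 : C * (h t - x) ≤ C * 1 := by gcongr; linarith
      linarith [F.hc]
    · have h2 := hup t x (x + 1) (by linarith) (by linarith)
      have h3 := F.le t (x + 1) (by linarith)
      have h4 := W.nonneg hx.le
      have : (deriv (fun y => u y t) x - C * (x + 1 - x)) * (x + 1 - x)
        = deriv (fun y => u y t) x - C := by ring
      linarith
  · intro h1
    have := hnear t x hx h1
    have : 0 ≤ M * (h t - x) := mul_nonneg hM.le (by linarith)
    linarith

/-- Multiplying `u` by a weight that increases towards the front produces a strict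
supersolution of the linearized equation, up to and including the front. -/
theorem IsAPSemiWave.weight_bound (W : IsAPSemiWave μ a ustar u h) {m A M K c : ℝ}
    (hm : 0 < m) (ham : ∀ x, m ≤ a x) (hA : ∀ x, a x ≤ A) (hstar : ∀ x, m / 2 ≤ ustar x)
    (F : FrontBounds u h M K c) :
    ∃ r > 0, r ≤ 1 ∧ ∃ δ > 0, ∀ t, ∀ x < h t, ∀ ζ, 0 ≤ ζ → ζ ≤ 1 →
      δ * (Real.exp (r * (x - h t)) + ζ) ≤
        -(deriv h t * (r * Real.exp (r * (x - h t))) + r ^ 2 * Real.exp (r * (x - h t))) * u x t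
        - 2 * (r * Real.exp (r * (x - h t))) * deriv (fun y => u y t) x
        + (Real.exp (r * (x - h t)) + ζ) * u x t ^ 2 := by
  obtain ⟨G, hG, hgrad⟩ := W.gradient_bounds hm ham hA hstar F
  have hM := F.hM
  have hK := F.hK
  have hc := F.hc
  set d := min (1 / 2) (c / (2 * G + (K + 1) * M)) with hd
  have hd0 : 0 < d := by positivity
  have hd1 : d ≤ 1 / 2 := min_le_left _ _
  have hd2 : (2 * G + (K + 1) * M) * d ≤ c := by
    calc (2 * G + (K + 1) * M) * d ≤ (2 * G + (K + 1) * M) * (c / (2 * G + (K + 1) * M)) := by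
          gcongr; exact min_le_right _ _
      _ = c := by field_simp
  set b := c * d with hb
  have hb0 : 0 < b := by positivity
  set r := min 1 (b ^ 2 / (2 * ((K + 1) * M + 2 * G))) with hr
  have hr0 : 0 < r := by positivity
  have hr1 : r ≤ 1 := min_le_left _ _
  have hr2 : r * ((K + 1) * M + 2 * G) ≤ b ^ 2 / 2 := by
    calc r * ((K + 1) * M + 2 * G)
        ≤ b ^ 2 / (2 * ((K + 1) * M + 2 * G)) * ((K + 1) * M + 2 * G) := by
          gcongr; exact min_le_right _ _
      _ = b ^ 2 / 2 := by field_simp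
  refine ⟨r, hr0, hr1, min (r * c / 3) (b ^ 2 / 2), by positivity, fun t x hx ζ hζ0 hζ1 => ?_⟩
  obtain ⟨hg1, hg2⟩ := hgrad t x hx
  set e := Real.exp (r * (x - h t)) with he
  have he0 : 0 < e := Real.exp_pos _
  set p := deriv (fun y => u y t) x with hp
  have hu0 := (W.pos t x hx).le
  have hh := F.speed_le t
  have hh0 := W.deriv_front_nonneg t
  have h1 : (deriv h t * (r * e) + r ^ 2 * e) * u x t ≤ r * e * ((K + 1) * u x t) := by
    have : deriv h t + r ≤ K + 1 := by linarith
    calc (deriv h t * (r * e) + r ^ 2 * e) * u x t = r * e * ((deriv h t + r) * u x t) := by ring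
      _ ≤ r * e * ((K + 1) * u x t) := by gcongr
  have hω : 0 < e + ζ := by linarith
  rcases le_total (h t - d) x with hn | hf
  · have hg3 := hg2 (by linarith)
    have h2 : G * (h t - x) ≤ G * d := by gcongr; linarith
    have h3 : u x t ≤ M * d := (F.le_lin t x hx.le).trans (by gcongr; linarith)
    have h4 : (K + 1) * u x t ≤ (K + 1) * (M * d) := by gcongr
    have h5 : c ≤ -(2 * p) - (K + 1) * u x t := by nlinarith
    have h6 : 1 / 2 ≤ e := by
      have := Real.add_one_le_exp (r * (x - h t))
      have : -(1 / 2) ≤ r * (x - h t) := by nlinarith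
      linarith
    have h7 : r * e * c ≤ r * e * (-(2 * p) - (K + 1) * u x t) := by gcongr
    have h8 : r * c / 3 * (e + ζ) ≤ r * e * c := by
      have : e + ζ ≤ 3 * e := by linarith
      calc r * c / 3 * (e + ζ) ≤ r * c / 3 * (3 * e) := by gcongr
        _ = r * e * c := by ring
    have h9 : min (r * c / 3) (b ^ 2 / 2) * (e + ζ) ≤ r * c / 3 * (e + ζ) := by
      gcongr; exact min_le_left _ _
    have h10 : 0 ≤ (e + ζ) * u x t ^ 2 := by positivity
    nlinarith
  · have h2 : b ≤ u x t := by
      refine le_trans ?_ (F.ge t x hx.le)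
      rw [hb]; gcongr
      exact le_min (by linarith) (by linarith)
    have h3 : (e + ζ) * b ^ 2 ≤ (e + ζ) * u x t ^ 2 := by gcongr
    have h4 : (K + 1) * u x t ≤ (K + 1) * M := by gcongr; exact F.le t x hx.le
    have h5 : r * e * ((K + 1) * u x t + 2 * p) ≤ e * (b ^ 2 / 2) := by
      calc r * e * ((K + 1) * u x t + 2 * p) ≤ r * e * ((K + 1) * M + 2 * G) := by
            gcongr; exact (le_abs_self p).trans hg1
        _ = e * (r * ((K + 1) * M + 2 * G)) := by ring
        _ ≤ e * (b ^ 2 / 2) := by gcongr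
    have h6 : min (r * c / 3) (b ^ 2 / 2) * (e + ζ) ≤ b ^ 2 / 2 * (e + ζ) := by
      gcongr; exact min_le_right _ _
    have h7 : e * (b ^ 2 / 2) ≤ (e + ζ) * (b ^ 2 / 2) := by gcongr; linarith
    nlinarith

end gradient

/-- A semi-wave together with all the bounds used in the comparison arguments. -/
structure TameSemiWave (μ : ℝ) (a ustar : ℝ → ℝ) (m A : ℝ) (u : ℝ → ℝ → ℝ) (h : ℝ → ℝ)
    (M K c : ℝ) : Prop where
  wave : IsAPSemiWave μ a ustar u h
  bounds : FrontBounds u h M K c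
  hμ : 0 < μ
  hm : 0 < m
  ham : ∀ x, m ≤ a x
  hA : ∀ x, a x ≤ A
  hstar : ∀ x, m / 2 ≤ ustar x

section increment

variable {μ m A M K c : ℝ} {a ustar : ℝ → ℝ} {u : ℝ → ℝ → ℝ} {h : ℝ → ℝ}

theorem TameSemiWave.mono_time (T : TameSemiWave μ a ustar m A u h M K c) {x s t : ℝ}
    (hx : x ≤ h s) (hst : s ≤ t) : u x s ≤ u x t :=
  T.wave.mono_time T.hm T.hstar T.bounds hx hst

theorem hasDerivAt_exp_mul (r y : ℝ) :
    HasDerivAt (fun y => Real.exp (r * y)) (r * Real.exp (r * y)) y := by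
  have := (Real.hasDerivAt_exp (r * y)).comp y ((hasDerivAt_id' y).const_mul r)
  exact this.congr_deriv (by ring)

theorem hasJet_exp_front {r ζ h' x t : ℝ} (hh : HasDerivAt h h' t) :
    HasJet (fun x t => Real.exp (r * (x - h t)) + ζ) x t
      (-h' * (r * Real.exp (r * (x - h t)))) (r * Real.exp (r * (x - h t)))
      (r ^ 2 * Real.exp (r * (x - h t))) :=
  HasJet.moving (g := fun y => Real.exp (r * y) + ζ) (g' := fun y => r * Real.exp (r * y))
    (g'' := fun y => r ^ 2 * Real.exp (r * y)) x
    (fun y => (hasDerivAt_exp_mul r y).add_const ζ)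
    (fun y => ((hasDerivAt_exp_mul r y).const_mul r).congr_deriv (by ring)) hh

/-- The weight inequality, as a predicate on the weight rate `r` and the gain `δ`. -/
def IsWeight (u : ℝ → ℝ → ℝ) (h : ℝ → ℝ) (r δ : ℝ) : Prop :=
  ∀ t, ∀ x < h t, ∀ ζ, 0 ≤ ζ → ζ ≤ 1 →
    δ * (Real.exp (r * (x - h t)) + ζ) ≤
      -(deriv h t * (r * Real.exp (r * (x - h t))) + r ^ 2 * Real.exp (r * (x - h t))) * u x t
      - 2 * (r * Real.exp (r * (x - h t))) * deriv (fun y => u y t) x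
      + (Real.exp (r * (x - h t)) + ζ) * u x t ^ 2

theorem TameSemiWave.increment_le_add (T : TameSemiWave μ a ustar m A u h M K c) {r δ N ε ζ : ℝ}
    (hr : 0 < r) (hr1 : r ≤ 1) (hw : IsWeight u h r δ) (hN0 : 0 < N)
    (hN : K + A + 3 ≤ N * δ) (hε : 0 < ε) (hζ : 0 < ζ) (hζ1 : ζ ≤ 1) (t₁ : ℝ) :
    ∀ x ≤ h t₁, u x (t₁ + ε) - u x t₁ ≤
      M * K * ε * ((Real.exp (r * (x - h t₁)) + ζ) * (N * u x t₁ + 1)) := by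
  have W := T.wave
  have hM := T.bounds.hM
  have hK := T.bounds.hK
  have hA0 : 0 < A := by linarith [T.hm, T.ham 0, T.hA 0]
  have hC0 : 0 < M * K * ε := by positivity
  set C₀ := M * K * ε with hC₀
  have hlow : ∀ t, ∀ x ≤ h t, C₀ * ζ ≤
      C₀ * ((Real.exp (r * (x - h t)) + ζ) * (N * u x t + 1)) := by
    intro t x hx
    have h1 := W.nonneg hx
    have h2 : 1 ≤ N * u x t + 1 := by have := mul_nonneg hN0.le h1; linarith
    have h3 := Real.exp_pos (r * (x - h t))
    gcongr
    calc ζ ≤ (Real.exp (r * (x - h t)) + ζ) * 1 := by linarith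
      _ ≤ _ := by gcongr
  obtain ⟨X, hX0, hX⟩ := W.far_field (ε := C₀ * ζ / 2) (by positivity)
  have hXt : ∀ t, ∀ x ≤ h t + X, u x (t + ε) - u x t ≤
      C₀ * ((Real.exp (r * (x - h t)) + ζ) * (N * u x t + 1)) := by
    intro t x hx
    have h0 : h t ≤ h (t + ε) := W.mono.monotone (by linarith)
    have h1 := (abs_lt.1 (hX t x hx)).1
    have h2 := (abs_lt.1 (hX (t + ε) x (by linarith))).2
    have h3 := hlow t x (by linarith)
    linarith
  intro x₁ hx₁
  rcases le_total x₁ (h t₁ + X) with hc | hc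
  · exact hXt t₁ x₁ hc
  have hcu : ContinuousOn (fun p : ℝ × ℝ => u p.1 p.2)
      {p : ℝ × ℝ | p.2 ≤ t₁ ∧ h p.2 + X ≤ p.1 ∧ p.1 ≤ h p.2} :=
    W.continuousOn fun p hp => hp.2.2
  have hch := W.continuous_front
  refine le_of_no_touching_ancient (l := fun t => h t + X) (r := h) (t₁ := t₁)
    (η := 1 / (N * M + 1)) (C := M / (C₀ * ζ)) (U := fun x t => u x (t + ε) - u x t)
    (Z := fun x t => C₀ * ((Real.exp (r * (x - h t)) + ζ) * (N * u x t + 1)))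
    (hch.add continuous_const) hch (by positivity) ?_ ?_ ?_ ?_ ?_ ?_ ?_ x₁ hc hx₁
  · refine ContinuousOn.sub ?_ hcu
    have := W.continuousOn (s := {p | p.1 ≤ h p.2}) fun p hp => hp
    refine this.comp (f := fun p : ℝ × ℝ => (p.1, p.2 + ε))
      (Continuous.continuousOn (by fun_prop)) ?_
    rintro ⟨x, t⟩ ⟨-, -, hx⟩
    change x ≤ h (t + ε)
    exact le_trans hx (W.mono.monotone (by linarith))
  · exact continuousOn_const.mul ((Continuous.continuousOn (by fun_prop)).mul
      ((continuousOn_const.mul hcu).add continuousOn_const))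
  · intro t _ x _ hx
    exact (by positivity : 0 < C₀ * ζ).trans_le (hlow t x hx)
  · intro t _ x _ hx
    have h0 : h t ≤ h (t + ε) := W.mono.monotone (by linarith)
    have h1 := T.bounds.le (t + ε) x (by linarith)
    have h2 := W.nonneg hx
    calc u x (t + ε) - u x t ≤ M := by linarith
      _ = M / (C₀ * ζ) * (C₀ * ζ) := by field_simp
      _ ≤ _ := mul_le_mul_of_nonneg_left (hlow t x hx) (by positivity)
  · intro t _ _
    exact hXt t _ le_rfl
  · intro t _ _
    have h0 : h t ≤ h (t + ε) := W.mono.monotone (by linarith)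
    have h1 := T.bounds.le_lin (t + ε) (h t) h0
    have h2 := T.bounds.front_sub_le W.differentiable_front (s := t) (t := t + ε) (by linarith)
    have h3 : M * (h (t + ε) - h t) ≤ C₀ := by
      calc M * (h (t + ε) - h t) ≤ M * (K * (t + ε - t)) := by gcongr
        _ = C₀ := by rw [hC₀]; ring
    simp only [W.sol.bdry t (mem_univ t), sub_self, mul_zero, Real.exp_zero, zero_add, mul_one,
      sub_zero]
    have : 0 ≤ C₀ * ζ := by positivity
    linarith
  · intro t _ x _ hx k hk hUk
    have h0 : h t ≤ h (t + ε) := W.mono.monotone (by linarith)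
    have hx2 : x < h (t + ε) := by linarith
    have hθ : HasDerivAt (fun t => t + ε) 1 t := (hasDerivAt_id' t).add_const ε
    refine ⟨_, _, _, _, _, _, (HasJet.reparam (θ := fun t => t + ε) (W.hasJet hx2) hθ).sub
      (W.hasJet hx), ((hasJet_exp_front (W.hasDerivAt_front t)).mul
      (((W.hasJet hx).const_mul N).add (HasJet.const 1 x t))).const_mul C₀, fun _ e2 => ?_⟩
    have hwt := hw t x hx ζ hζ.le hζ1
    have hmono := T.mono_time hx.le (show t ≤ t + ε by linarith)
    have hv0 := (W.pos t x hx)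
    have hvM := T.bounds.le t x hx.le
    have hax := T.hA x
    have hh := T.bounds.speed_le t
    rw [W.pde hx, W.pde hx2]
    set e := Real.exp (r * (x - h t))
    have he0 : 0 < e := Real.exp_pos _
    set p := deriv (fun y => u y t) x
    set v := u x t
    set w := u x (t + ε)
    set wxx := deriv (deriv fun y => u y (t + ε)) x
    set vxx := deriv (deriv fun y => u y t) x
    set h' := deriv h t
    have hω : 0 < e + ζ := by linarith
    have i1 : (h' * r + r ^ 2) * e ≤ (K + 1) * (e + ζ) := by
      have : h' * r + r ^ 2 ≤ K + 1 := by
        have : r ^ 2 ≤ 1 := by nlinarith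
        have : h' * r ≤ K * 1 := by
          calc h' * r ≤ K * r := by gcongr
            _ ≤ K * 1 := by gcongr
        linarith
      calc (h' * r + r ^ 2) * e ≤ (K + 1) * e := by gcongr
        _ ≤ (K + 1) * (e + ζ) := by gcongr; linarith
    have i2 : (K + A + 3) * (e + ζ) ≤ N * (δ * (e + ζ)) := by
      rw [← mul_assoc]; gcongr
    have i3 := mul_le_mul_of_nonneg_left hwt hN0.le
    have i4 : (e + ζ) * (a x - w - v) ≤ (e + ζ) * A := by gcongr; linarith
    have i5 : 0 ≤ (e + ζ) * N * v * (w - v) := by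
      have : 0 ≤ w - v := by linarith
      positivity
    have i6 : 1 / (N * M + 1) * ((e + ζ) * (N * v + 1)) ≤ e + ζ := by
      calc 1 / (N * M + 1) * ((e + ζ) * (N * v + 1))
          ≤ 1 / (N * M + 1) * ((e + ζ) * (N * M + 1)) := by gcongr
        _ = e + ζ := by field_simp
    have main : 0 < (-h' * (r * e) * (N * v + 1) + (e + ζ) * (N * (vxx + v * (a x - v))))
        - (r ^ 2 * e * (N * v + 1) + 2 * (r * e * (N * p)) + (e + ζ) * (N * vxx))
        - (e + ζ) * (N * v + 1) * (a x - w - v)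
        - 1 / (N * M + 1) * ((e + ζ) * (N * v + 1)) := by
      linarith
    have hkC : 0 < k * C₀ := by positivity
    have main' := mul_pos hkC main
    have e3 : (w - v) * (a x - w - v) = k * (C₀ * ((e + ζ) * (N * v + 1))) * (a x - w - v) := by
      rw [hUk]
    linarith

/-- Time increments of a semi-wave decay exponentially away from the front. -/
theorem TameSemiWave.increment_le (T : TameSemiWave μ a ustar m A u h M K c) {r δ : ℝ}
    (hr : 0 < r) (hr1 : r ≤ 1) (hδ : 0 < δ) (hw : IsWeight u h r δ) :
    ∃ C > 0, ∀ ε > 0, ∀ t, ∀ x ≤ h t,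
      u x (t + ε) - u x t ≤ C * ε * Real.exp (r * (x - h t)) := by
  have hM := T.bounds.hM
  have hK := T.bounds.hK
  have hA0 : 0 < A := by linarith [T.hm, T.ham 0, T.hA 0]
  set N := (K + A + 3) / δ with hN
  have hN0 : 0 < N := by positivity
  refine ⟨M * K * (N * M + 1), by positivity, fun ε hε t x hx => ?_⟩
  set e := Real.exp (r * (x - h t)) with he
  have hlim : Tendsto (fun ζ : ℝ => M * K * ε * ((e + ζ) * (N * u x t + 1))) (𝓝[>] 0)
      (𝓝 (M * K * ε * ((e + 0) * (N * u x t + 1)))) :=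
    ((by fun_prop : Continuous fun ζ : ℝ => M * K * ε * ((e + ζ) * (N * u x t + 1))).tendsto
      0).mono_left nhdsWithin_le_nhds
  have h1 : u x (t + ε) - u x t ≤ M * K * ε * ((e + 0) * (N * u x t + 1)) := by
    refine ge_of_tendsto hlim ?_
    filter_upwards [Ioc_mem_nhdsGT one_pos] with ζ hζ
    exact T.increment_le_add hr hr1 hw hN0 (by rw [hN]; field_simp; rfl) hε hζ.1 hζ.2 t x hx
  have h2 : N * u x t + 1 ≤ N * M + 1 := by gcongr; exact T.bounds.le t x hx
  calc u x (t + ε) - u x t ≤ M * K * ε * ((e + 0) * (N * u x t + 1)) := h1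
    _ ≤ M * K * ε * ((e + 0) * (N * M + 1)) := by
      have : 0 < e := Real.exp_pos _
      gcongr
    _ = _ := by ring

end increment

section stability

variable {μ m A M₁ K₁ c₁ M K c : ℝ} {a ustar : ℝ → ℝ} {u₁ u₂ : ℝ → ℝ → ℝ} {h₁ h₂ : ℝ → ℝ}

/-- Comparison with a perturbed time change of a semi-wave, as long as the fronts are ordered. -/
theorem TameSemiWave.le_perturbed (T₁ : TameSemiWave μ a ustar m A u₁ h₁ M₁ K₁ c₁)
    (T₂ : TameSemiWave μ a ustar m A u₂ h₂ M K c) {r δ δ' : ℝ} (hr : 0 < r) (hr1 : r ≤ 1) (hδ' : 0 ≤ δ')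
    (hw : IsWeight u₂ h₂ r δ) {q θ : ℝ → ℝ} (hq0 : ∀ t, 0 < q t)
    (hq : ∀ t, HasDerivAt q (-(δ' * q t)) t) (hqa : Antitone q)
    (hθ : ∀ t, HasDerivAt θ (1 + 3 * q t) t) {t₀ t₁ : ℝ}
    (hsmall : ∀ t, t₀ ≤ t → 3 * q t * K * M + δ' * M ≤ δ)
    (hfront : ∀ t ∈ Icc t₀ t₁, h₁ t < h₂ (θ t))
    (hinit : ∀ x ≤ h₁ t₀, u₁ x t₀ ≤ (1 + q t₀) * u₂ x (θ t₀)) :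
    ∀ t ∈ Icc t₀ t₁, ∀ x ≤ h₁ t, u₁ x t ≤
      u₂ x (θ t) * (1 + q t * (Real.exp (r * (x - h₂ (θ t))) + 1)) := by
  have W₁ := T₁.wave
  have W₂ := T₂.wave
  have hM := T₂.bounds.hM
  have hK := T₂.bounds.hK
  have hcθ : Continuous θ := continuous_iff_continuousAt.2 fun t => (hθ t).continuousAt
  have hcq : Continuous q := continuous_iff_continuousAt.2 fun t => (hq t).continuousAt
  have hc1 := W₁.continuous_front
  have hc2 := W₂.continuous_front
  have hge : ∀ t, ∀ x ≤ h₂ (θ t), (1 + q t) * u₂ x (θ t) ≤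
      u₂ x (θ t) * (1 + q t * (Real.exp (r * (x - h₂ (θ t))) + 1)) := by
    intro t x hx
    have h1 := W₂.nonneg hx
    have h2 := hq0 t
    have h3 := Real.exp_pos (r * (x - h₂ (θ t)))
    have : 0 ≤ u₂ x (θ t) * (q t * Real.exp (r * (x - h₂ (θ t)))) := by positivity
    linarith
  obtain ⟨X, hX0, hX⟩ := W₁.far_ratio W₂ T₁.hm T₁.hstar (hq0 t₁)
  have hXt : ∀ t ∈ Icc t₀ t₁, ∀ x ≤ h₁ t + X, u₁ x t ≤
      u₂ x (θ t) * (1 + q t * (Real.exp (r * (x - h₂ (θ t))) + 1)) := by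
    intro t ht x hx
    have h0 := hfront t ht
    have h1 := hX t (θ t) x hx (by linarith)
    have h2 := hqa ht.2
    have h3 : 0 ≤ u₂ x (θ t) := W₂.nonneg (by linarith)
    calc u₁ x t ≤ (1 + q t₁) * u₂ x (θ t) := h1
      _ ≤ (1 + q t) * u₂ x (θ t) := by gcongr
      _ ≤ _ := hge t x (by linarith)
  intro t ht x hx
  rcases le_total x (h₁ t + X) with hc | hc
  · exact hXt t ht x hc
  refine le_of_no_touching (l := fun t => h₁ t + X) (r := h₁) (t₀ := t₀) (t₁ := t₁)
    (U := u₁)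
    (Z := fun x t => u₂ x (θ t) * (1 + q t * (Real.exp (r * (x - h₂ (θ t))) + 1)))
    (hc1.add continuous_const) hc1 (W₁.continuousOn fun p hp => hp.2.2) ?_ ?_ ?_ ?_ ?_ ?_
    t ht x hc hx
  · refine ContinuousOn.mul ?_ (Continuous.continuousOn (by fun_prop))
    have := W₂.continuousOn (s := {p | p.1 ≤ h₂ p.2}) fun p hp => hp
    refine this.comp (f := fun p : ℝ × ℝ => (p.1, θ p.2))
      (Continuous.continuousOn (by fun_prop)) ?_
    rintro ⟨x, t⟩ ⟨ht, -, hx⟩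
    exact le_trans hx (hfront t ht).le
  · intro t ht x _ hx
    have h1 : 0 < u₂ x (θ t) := W₂.pos _ x (hx.trans_lt (hfront t ht))
    have h2 := hq0 t
    positivity
  · intro x _ hx
    have ht0 : t₀ ∈ Icc t₀ t₁ := ⟨le_rfl, ht.1.trans ht.2⟩
    exact (hinit x hx).trans (hge t₀ x (hx.trans (hfront t₀ ht0).le))
  · intro t ht _
    exact hXt t ht _ le_rfl
  · intro t ht _
    have h1 : 0 < u₂ (h₁ t) (θ t) := W₂.pos _ _ (hfront t ht)
    have h2 := hq0 t
    rw [W₁.sol.bdry t (mem_univ t)]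
    positivity
  · intro t ht x _ hx k hk hUk
    have ht' : t ∈ Icc t₀ t₁ := ⟨ht.1.le, ht.2⟩
    have hx2 : x < h₂ (θ t) := hx.trans (hfront t ht')
    have hH : HasDerivAt (fun t => h₂ (θ t)) (deriv h₂ (θ t) * (1 + 3 * q t)) t :=
      (W₂.hasDerivAt_front (θ t)).comp t (hθ t)
    refine ⟨_, _, _, _, _, _, W₁.hasJet hx, (HasJet.reparam (W₂.hasJet hx2) (hθ t)).mul
      ((HasJet.const 1 x t).add ((HasJet.of_time x (hq t)).mul
      (hasJet_exp_front (r := r) (ζ := 1) hH))), fun _ e2 => ?_⟩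
    have hwt := hw (θ t) x hx2 1 zero_le_one le_rfl
    have hut := W₂.deriv_time_nonneg T₂.hm T₂.hstar T₂.bounds hx2
    have hv0 := (W₂.pos (θ t) x hx2)
    have hvM := T₂.bounds.le (θ t) x hx2.le
    have hh := T₂.bounds.speed_le (θ t)
    have hh0 := W₂.deriv_front_nonneg (θ t)
    have hs := hsmall t ht'.1
    have hqt := hq0 t
    have hpde := W₂.pde hx2
    rw [W₁.pde hx, hUk]
    set e := Real.exp (r * (x - h₂ (θ t)))
    have he0 : 0 < e := Real.exp_pos _
    set p := deriv (fun y => u₂ y (θ t)) x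
    set v := u₂ x (θ t)
    set vt := deriv (fun s => u₂ x s) (θ t)
    set vxx := deriv (deriv fun y => u₂ y (θ t)) x
    set h' := deriv h₂ (θ t)
    set Q := q t
    set g := 1 + Q * (e + 1) with hg
    have hg1 : 1 ≤ g := by
      have : 0 ≤ Q * (e + 1) := by positivity
      linarith
    have hP : 0 < v * g := by positivity
    have i1 : k * (v * g) * (a x - k * (v * g)) < k * (v * g) * (a x - v * g) := by
      refine mul_lt_mul_of_pos_left ?_ (by positivity)
      have : 1 * (v * g) < k * (v * g) := mul_lt_mul_of_pos_right hk hP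
      linarith
    have i2 : 3 * Q * (h' * (r * e) * v) ≤ 3 * Q * (K * M) * (e + 1) := by
      have : h' * (r * e) * v ≤ K * (1 * (e + 1)) * M := by
        gcongr; linarith
      calc 3 * Q * (h' * (r * e) * v) ≤ 3 * Q * (K * (1 * (e + 1)) * M) := by gcongr
        _ = _ := by ring
    have i3 : δ' * v * (e + 1) ≤ δ' * M * (e + 1) := by gcongr
    have i4 : (3 * Q * K * M + δ' * M) * (e + 1) ≤ δ * (e + 1) := by gcongr
    have i5 : 0 ≤ 3 * Q * vt * g := by positivity
    have i6 : 0 ≤ v ^ 2 * Q * (e + 1) * (Q * (e + 1)) := by positivity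
    have i7 := mul_le_mul_of_nonneg_left (hwt.trans' (i4.trans' (add_le_add i2 i3 |>.trans_eq
      (by ring : _ = (3 * Q * K * M + δ' * M) * (e + 1))))) hqt.le
    have main : 0 ≤ (1 + 3 * Q) * vt * g + v * (-(δ' * Q) * (e + 1) +
        Q * (-(h' * (1 + 3 * Q)) * (r * e))) - (vxx * g + 2 * (p * (Q * (r * e))) +
        v * (Q * (r ^ 2 * e))) - v * g * (a x - v * g) := by
      have : (1 + 3 * Q) * vt * g + v * (-(δ' * Q) * (e + 1) +
        Q * (-(h' * (1 + 3 * Q)) * (r * e))) - (vxx * g + 2 * (p * (Q * (r * e))) +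
        v * (Q * (r ^ 2 * e))) - v * g * (a x - v * g) =
        3 * Q * vt * g + v ^ 2 * Q * (e + 1) * (Q * (e + 1)) +
        Q * (-(h' * (r * e) + r ^ 2 * e) * v - 2 * (r * e) * p + (e + 1) * v ^ 2)
        - Q * (3 * Q * (h' * (r * e) * v) + δ' * v * (e + 1)) := by
        rw [hpde, hg]; ring
      linarith
    have main' := mul_nonneg (by linarith : (0 : ℝ) ≤ k) main
    linarith

/-- If the front of `u₁` touches that of a slightly perturbed `u₂`, its speed is at most
slightly larger. -/
theorem TameSemiWave.front_speed_le_of_le (T₁ : TameSemiWave μ a ustar m A u₁ h₁ M₁ K₁ c₁)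
    (T₂ : TameSemiWave μ a ustar m A u₂ h₂ M K c) {s t B : ℝ} (heq : h₁ t = h₂ s)
    (hle : ∀ x < h₁ t, u₁ x t ≤ B * u₂ x s) : deriv h₁ t ≤ B * deriv h₂ s := by
  have d1 := T₁.wave.hasDerivAt_at_front T₁.bounds t
  have d2 := T₂.wave.hasDerivAt_at_front T₂.bounds s
  rw [T₁.wave.sol.stefan t (mem_univ t), T₂.wave.sol.stefan s (mem_univ s)]
  rw [← heq] at d2 ⊢
  have h1 := deriv_nonneg_of_left_max (d1.sub (d2.const_mul B)) (by
    filter_upwards [self_mem_nhdsWithin] with x hx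
    have e1 := T₁.wave.sol.bdry t (mem_univ t)
    have e2 := T₂.wave.sol.bdry s (mem_univ s)
    rw [← heq] at e2
    have := hle x hx
    simp only [Pi.sub_apply, e1, e2]
    linarith)
  have := mul_nonneg T₁.hμ.le h1
  linarith

theorem TameSemiWave.front_lt_perturbed (T₁ : TameSemiWave μ a ustar m A u₁ h₁ M₁ K₁ c₁)
    (T₂ : TameSemiWave μ a ustar m A u₂ h₂ M K c) {r δ δ' : ℝ} (hr : 0 < r) (hr1 : r ≤ 1)
    (hδ' : 0 ≤ δ') (hw : IsWeight u₂ h₂ r δ) {q θ : ℝ → ℝ} (hq0 : ∀ t, 0 < q t)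
    (hq : ∀ t, HasDerivAt q (-(δ' * q t)) t) (hqa : Antitone q)
    (hθ : ∀ t, HasDerivAt θ (1 + 3 * q t) t) {t₀ : ℝ}
    (hsmall : ∀ t, t₀ ≤ t → 3 * q t * K * M + δ' * M ≤ δ)
    (hfront : h₁ t₀ < h₂ (θ t₀))
    (hinit : ∀ x ≤ h₁ t₀, u₁ x t₀ ≤ (1 + q t₀) * u₂ x (θ t₀)) :
    ∀ t, t₀ ≤ t → h₁ t < h₂ (θ t) := by
  have W₁ := T₁.wave
  have W₂ := T₂.wave
  have hcθ : Continuous θ := continuous_iff_continuousAt.2 fun t => (hθ t).continuousAt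
  have hcq : Continuous q := continuous_iff_continuousAt.2 fun t => (hq t).continuousAt
  have hc1 := W₁.continuous_front
  have hc2 : Continuous fun t => h₂ (θ t) := W₂.continuous_front.comp hcθ
  intro t₂ ht₂
  by_contra! hcon
  have hcomp : IsCompact (Icc t₀ t₂ ∩ {t | h₂ (θ t) ≤ h₁ t}) :=
    isCompact_Icc.inter_right (isClosed_le hc2 hc1)
  obtain ⟨t₁, ⟨ht₁, hge⟩, hleast⟩ := hcomp.exists_isLeast ⟨t₂, ⟨ht₂, le_rfl⟩, hcon⟩
  have hbefore : ∀ t, t₀ ≤ t → t < t₁ → h₁ t < h₂ (θ t) := by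
    intro t h1 h2
    by_contra! h3
    exact absurd (hleast ⟨⟨h1, h2.le.trans ht₁.2⟩, h3⟩) (not_le.2 h2)
  have hge : h₂ (θ t₁) ≤ h₁ t₁ := hge
  have ht01 : t₀ < t₁ := by
    rcases ht₁.1.lt_or_eq with h | h
    · exact h
    · rw [← h] at hge; linarith
  have hev : ∀ᶠ t in 𝓝[<] t₁, t₀ < t ∧ t < t₁ :=
    (Ioo_mem_nhdsLT ht01 : Ioo t₀ t₁ ∈ 𝓝[<] t₁)
  have hle : h₁ t₁ ≤ h₂ (θ t₁) := by
    refine le_of_tendsto_of_tendsto (hc1.tendsto t₁ |>.mono_left nhdsWithin_le_nhds)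
      (hc2.tendsto t₁ |>.mono_left nhdsWithin_le_nhds) (b := 𝓝[<] t₁) ?_
    filter_upwards [hev] with t ht using (hbefore t ht.1.le ht.2).le
  have heq := le_antisymm hle hge
  have hcmp : ∀ x < h₁ t₁, u₁ x t₁ ≤ (1 + 2 * q t₁) * u₂ x (θ t₁) := by
    intro x hx
    have hx2 : x < h₂ (θ t₁) := hx.trans_le hle
    have l1 : Tendsto (fun t => u₁ x t) (𝓝[<] t₁) (𝓝 (u₁ x t₁)) :=
      (W₁.hasJet hx).dt.continuousAt.tendsto.mono_left nhdsWithin_le_nhds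
    have l2 : Tendsto (fun t => u₂ x (θ t)) (𝓝[<] t₁) (𝓝 (u₂ x (θ t₁))) :=
      (((W₂.hasJet hx2).dt.comp t₁ (hθ t₁)).continuousAt.tendsto).mono_left nhdsWithin_le_nhds
    have l3 : Tendsto (fun t => 1 + 2 * q t) (𝓝[<] t₁) (𝓝 (1 + 2 * q t₁)) :=
      ((by fun_prop : Continuous fun t => 1 + 2 * q t).tendsto t₁).mono_left nhdsWithin_le_nhds
    refine le_of_tendsto_of_tendsto l1 (l3.mul l2) ?_
    filter_upwards [hev, nhdsWithin_le_nhds (hc1.continuousAt.eventually_const_lt hx)]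
      with t ht hxt
    have h1 := T₁.le_perturbed T₂ hr hr1 hδ' hw hq0 hq hqa hθ (t₁ := t) hsmall
      (fun s hs => hbefore s hs.1 (hs.2.trans_lt ht.2)) hinit t ⟨ht.1.le, le_rfl⟩ x hxt.le
    have h2 := hbefore t ht.1.le ht.2
    have h3 := hq0 t
    have h4 : 0 ≤ u₂ x (θ t) := W₂.nonneg (by linarith)
    have h5 : Real.exp (r * (x - h₂ (θ t))) ≤ 1 := by
      rw [Real.exp_le_one_iff]
      exact mul_nonpos_of_nonneg_of_nonpos hr.le (by linarith)
    calc u₁ x t ≤ _ := h1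
      _ ≤ u₂ x (θ t) * (1 + q t * (1 + 1)) := by gcongr
      _ = (1 + 2 * q t) * u₂ x (θ t) := by ring
  have hsp := T₁.front_speed_le_of_le T₂ heq hcmp
  have hH : HasDerivAt (fun t => h₂ (θ t)) (deriv h₂ (θ t₁) * (1 + 3 * q t₁)) t₁ :=
    (W₂.hasDerivAt_front (θ t₁)).comp t₁ (hθ t₁)
  have h1 := deriv_nonneg_of_left_max ((W₁.hasDerivAt_front t₁).sub hH) (by
    filter_upwards [hev] with t ht
    have := hbefore t ht.1.le ht.2
    simp only [Pi.sub_apply, heq, sub_self]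
    linarith)
  have h2 : 0 < q t₁ * deriv h₂ (θ t₁) :=
    mul_pos (hq0 t₁) (T₂.bounds.hc.trans_le (T₂.bounds.speed_ge _))
  linarith

/-- Stability of the front position under small relative perturbations. -/
theorem TameSemiWave.front_stability (T₁ : TameSemiWave μ a ustar m A u₁ h₁ M₁ K₁ c₁)
    (T₂ : TameSemiWave μ a ustar m A u₂ h₂ M K c) {r δ : ℝ} (hr : 0 < r) (hr1 : r ≤ 1)
    (hδ : 0 < δ) (hw : IsWeight u₂ h₂ r δ) :
    ∃ q₀ > 0, ∃ Q > 0, ∀ q, 0 < q → q ≤ q₀ → ∀ t₀ s₀, h₁ t₀ < h₂ s₀ →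
      (∀ x ≤ h₁ t₀, u₁ x t₀ ≤ (1 + q) * u₂ x s₀) →
      ∀ t, t₀ ≤ t → h₁ t ≤ h₂ (s₀ + (t - t₀) + Q * q) := by
  have hM := T₂.bounds.hM
  have hK := T₂.bounds.hK
  set δ' := δ / (2 * M) with hδ'
  have hδ'0 : 0 < δ' := by positivity
  refine ⟨δ / (6 * K * M), by positivity, 3 / δ', by positivity, ?_⟩
  intro q hq0 hq t₀ s₀ hfr hin t ht
  set E : ℝ → ℝ := fun t => Real.exp (-δ' * (t - t₀)) with hE
  have hEd : ∀ t, HasDerivAt E (-δ' * E t) t := by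
    intro t
    have := (hasDerivAt_exp_mul (-δ') (t - t₀)).comp_sub_const t t₀
    exact this
  have hE0 : ∀ t, 0 < E t := fun t => Real.exp_pos _
  have hE1 : ∀ t, t₀ ≤ t → E t ≤ 1 := by
    intro t ht
    rw [hE, Real.exp_le_one_iff]
    nlinarith
  have hEa : Antitone E := by
    intro s t hst
    apply Real.exp_le_exp.2
    nlinarith
  have hEt0 : E t₀ = 1 := by simp [hE]
  have key := T₁.front_lt_perturbed T₂ (δ' := δ') hr hr1 hδ'0.le hw (q := fun t => q * E t)
    (θ := fun t => s₀ + (t - t₀) + 3 * q / δ' * (1 - E t)) (t₀ := t₀)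
    (fun t => mul_pos hq0 (hE0 t)) (fun t => ((hEd t).const_mul q).congr_deriv (by ring))
    (fun s t hst => mul_le_mul_of_nonneg_left (hEa hst) hq0.le)
    (fun t => by
      have := (((hasDerivAt_id' t).sub_const t₀).const_add s₀).add
        (((hEd t).const_sub 1).const_mul (3 * q / δ'))
      refine this.congr_deriv ?_
      field_simp)
    (fun t ht => by
      have h1 : q * E t ≤ δ / (6 * K * M) := by nlinarith [hE1 t ht, hE0 t]
      have h2 : δ' * M = δ / 2 := by rw [hδ']; field_simp
      have h3 : 3 * (q * E t) * K * M ≤ 3 * (δ / (6 * K * M)) * K * M := by gcongr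
      have h4 : 3 * (δ / (6 * K * M)) * K * M = δ / 2 := by field_simp; norm_num
      linarith)
    (by simpa [hEt0] using hfr) (by simpa [hEt0] using hin) t ht
  refine key.le.trans (T₂.wave.mono.monotone ?_)
  have : 3 * q / δ' * (1 - E t) ≤ 3 * q / δ' * 1 := by
    gcongr; linarith [hE0 t]
  have e : 3 * q / δ' * 1 = 3 / δ' * q := by ring
  linarith

end stability

section asymptotics

variable {μ m A M₁ K₁ c₁ M K c : ℝ} {a ustar : ℝ → ℝ} {u₁ u₂ : ℝ → ℝ → ℝ} {h₁ h₂ : ℝ → ℝ}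

theorem TameSemiWave.exists_weight (T₂ : TameSemiWave μ a ustar m A u₂ h₂ M K c) :
    ∃ r > 0, r ≤ 1 ∧ ∃ δ > 0, IsWeight u₂ h₂ r δ :=
  T₂.wave.weight_bound T₂.hm T₂.ham T₂.hA T₂.hstar T₂.bounds

/-- Once the front of `u₁` is behind that of `u₂`, it never gets more than a fixed time ahead. -/
theorem TameSemiWave.front_le_add_const (T₁ : TameSemiWave μ a ustar m A u₁ h₁ M₁ K₁ c₁)
    (T₂ : TameSemiWave μ a ustar m A u₂ h₂ M K c) :
    ∃ C, ∀ t₀ s₀, h₁ t₀ ≤ h₂ s₀ → ∀ t, t₀ ≤ t → h₁ t ≤ h₂ (s₀ + (t - t₀) + C) := by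
  obtain ⟨r, hr, hr1, δ, hδ, hw⟩ := T₂.exists_weight
  obtain ⟨q₀, hq₀, Q, hQ, hst⟩ := T₁.front_stability T₂ hr hr1 hδ hw
  obtain ⟨X, hX0, hX⟩ := T₁.wave.far_ratio T₂.wave T₁.hm T₁.hstar hq₀
  have hc := T₂.bounds.hc
  have hc₁ := T₁.bounds.hc
  refine ⟨-X / c + Q * q₀, fun t₀ s₀ h0 t ht => ?_⟩
  have hXc : 0 < -X / c := div_pos (by linarith) hc
  have hXc₁ : 0 < -X / c₁ := div_pos (by linarith) hc₁
  have h1 := T₂.bounds.le_front_sub T₂.wave.differentiable_front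
    (s := s₀) (t := s₀ + -X / c) (by linarith)
  have h2 := T₁.bounds.le_front_sub T₁.wave.differentiable_front
    (s := t₀) (t := t₀ + -X / c₁) (by linarith)
  have e1 : c * (s₀ + -X / c - s₀) = -X := by field_simp; ring
  have e2 : c₁ * (t₀ + -X / c₁ - t₀) = -X := by field_simp; ring
  have := hst q₀ hq₀ le_rfl t₀ (s₀ + -X / c) (by linarith) (fun x hx => by
    refine (T₁.mono_time hx (t := t₀ + -X / c₁) (by linarith)).trans ?_
    exact hX _ _ x (by linarith) (by linarith)) t ht
  convert this using 2; ring

/-- Ordering of the solutions at one time implies ordering of the fronts afterwards. -/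
theorem TameSemiWave.front_le_of_le (T₁ : TameSemiWave μ a ustar m A u₁ h₁ M₁ K₁ c₁)
    (T₂ : TameSemiWave μ a ustar m A u₂ h₂ M K c) {t₀ s₀ : ℝ} (h0 : h₁ t₀ ≤ h₂ s₀)
    (hle : ∀ x ≤ h₁ t₀, u₁ x t₀ ≤ u₂ x s₀) {t : ℝ} (ht : t₀ ≤ t) :
    h₁ t ≤ h₂ (s₀ + (t - t₀)) := by
  obtain ⟨r, hr, hr1, δ, hδ, hw⟩ := T₂.exists_weight
  obtain ⟨q₀, hq₀, Q, hQ, hst⟩ := T₁.front_stability T₂ hr hr1 hδ hw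
  have hlim : Tendsto (fun q => h₂ (s₀ + q + (t - t₀) + Q * q)) (𝓝[>] 0)
      (𝓝 (h₂ (s₀ + (t - t₀)))) := by
    have hc2 := T₂.wave.continuous_front
    have := (by fun_prop : Continuous fun q => h₂ (s₀ + q + (t - t₀) + Q * q)).tendsto 0
    simp only [add_zero, mul_zero] at this
    exact this.mono_left nhdsWithin_le_nhds
  refine ge_of_tendsto hlim ?_
  filter_upwards [Ioc_mem_nhdsGT hq₀] with q hq
  refine hst q hq.1 hq.2 t₀ (s₀ + q) (h0.trans_lt (T₂.wave.mono (by linarith [hq.1]))) ?_ t ht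
  intro x hx
  have h1 := hle x hx
  have h2 := T₂.mono_time (hx.trans h0) (t := s₀ + q) (by linarith [hq.1])
  have h3 := T₁.wave.nonneg hx
  nlinarith [hq.1]

theorem TameSemiWave.front_le_of_front_le (T₁ : TameSemiWave μ a ustar m A u₁ h₁ M₁ K₁ c₁)
    (T₂ : TameSemiWave μ a ustar m A u₂ h₂ M K c) {s t₁ : ℝ}
    (hle : ∀ t ≤ t₁, h₁ t ≤ h₂ (t + s)) (t : ℝ) : h₁ t ≤ h₂ (t + s) := by
  rcases le_total t t₁ with h | h
  · exact hle t h
  · have := T₁.front_le_of_le T₂ (hle t₁ le_rfl)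
      (T₁.wave.le_of_front_le T₂.wave T₁.hm T₁.hstar T₁.bounds T₂.bounds hle) h
    convert this using 2; ring

theorem TameSemiWave.front_gap (T₁ : TameSemiWave μ a ustar m A u₁ h₁ M₁ K₁ c₁)
    (T₂ : TameSemiWave μ a ustar m A u₂ h₂ M K c) {κ τ S t₀ : ℝ} (hκ : 0 < κ)
    (hτ : K₁ * τ ≤ c * κ / 2) (hgap : h₁ t₀ ≤ h₂ (t₀ + S - κ)) {t : ℝ}
    (ht : t ∈ Icc t₀ (t₀ + τ)) : h₁ t + c * κ / 2 ≤ h₂ (t + S) := by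
  have h1 := T₁.bounds.front_sub_le T₁.wave.differentiable_front ht.1
  have h2 := T₂.bounds.le_front_sub T₂.wave.differentiable_front
    (s := t₀ + S - κ) (t := t₀ + S) (by linarith)
  have h3 : h₂ (t₀ + S) ≤ h₂ (t + S) := T₂.wave.mono.monotone (by linarith [ht.1])
  have h4 : K₁ * (t - t₀) ≤ K₁ * τ :=
    mul_le_mul_of_nonneg_left (by linarith [ht.2]) T₁.bounds.hK.le
  have e : c * (t₀ + S - (t₀ + S - κ)) = c * κ := by ring
  linarith

/-- A gap between the fronts propagates into the interior. -/
theorem TameSemiWave.spreading (T₁ : TameSemiWave μ a ustar m A u₁ h₁ M₁ K₁ c₁)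
    (T₂ : TameSemiWave μ a ustar m A u₂ h₂ M K c) {κ τ L : ℝ} (hκ : 0 < κ) (hτ0 : 0 < τ)
    (hτ : K₁ * τ ≤ c * κ / 2) (hL : 0 < L) :
    ∃ ρ > 0, ∀ S, (∀ t, h₁ t ≤ h₂ (t + S)) → ∀ t₀, h₁ t₀ ≤ h₂ (t₀ + S - κ) →
      ∀ x, h₁ (t₀ + τ) - L ≤ x → x ≤ h₁ (t₀ + τ) →
        u₁ x (t₀ + τ) + ρ ≤ u₂ x (t₀ + τ + S) := by
  have hc := T₂.bounds.hc
  have hM := T₂.bounds.hM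
  have hM₁ := T₁.bounds.hM
  have hA0 : 0 < A := by linarith [T₁.hm, T₁.ham 0, T₁.hA 0]
  have W₁ := T₁.wave
  have W₂ := T₂.wave
  set V := (L + 1) / τ with hV
  have hV0 : 0 < V := by positivity
  have hVτ : V * τ = L + 1 := by rw [hV]; field_simp
  set Γ := M₁ + M with hΓ
  set B := V + Γ + 1 with hB
  have hB1 : 1 ≤ B := by linarith
  set b := c * min (c * κ / 2) 1 with hb
  have hb0 : 0 < b := by positivity
  set b' := b / Real.exp (B * (L + 1)) with hb'
  have hb'0 : 0 < b' := by positivity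
  have hbe : b' * Real.exp (B * (L + 1)) = b := by rw [hb']; field_simp
  refine ⟨b' * B, by positivity, fun S hS t₀ hgap x hx1 hx2 => ?_⟩
  have hord : ∀ t, ∀ x ≤ h₁ t, u₁ x t ≤ u₂ x (t + S) := fun t x hx =>
    W₁.le_of_front_le W₂ T₁.hm T₁.hstar T₁.bounds T₂.bounds (fun t _ => hS t) x hx
  have hc1 := W₁.continuous_front
  have ht₁ : t₀ + τ ∈ Icc t₀ (t₀ + τ) := ⟨by linarith, le_rfl⟩
  have key := le_of_no_touching (l := fun t => h₁ t - L - 1) (r := h₁) (t₀ := t₀) (t₁ := t₀ + τ)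
    (U := fun x t => 1 + (b' * (Real.exp (B * (x - (h₁ t - V * (t - t₀)))) + -1) -
      (u₂ x (t + S) - u₁ x t))) (Z := fun _ _ => 1)
    (by fun_prop) hc1 ?_ continuousOn_const (fun _ _ _ _ _ => one_pos) ?_ ?_ ?_ ?_
    (t₀ + τ) ht₁ x (by linarith) hx2
  · have h1 : 1 ≤ x - (h₁ (t₀ + τ) - V * (t₀ + τ - t₀)) := by
      have : V * (t₀ + τ - t₀) = L + 1 := by rw [← hVτ]; ring
      linarith
    have h2 : B ≤ B * (x - (h₁ (t₀ + τ) - V * (t₀ + τ - t₀))) := by nlinarith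
    have h3 := Real.add_one_le_exp (B * (x - (h₁ (t₀ + τ) - V * (t₀ + τ - t₀))))
    have h4 : b' * B ≤ b' * (Real.exp (B * (x - (h₁ (t₀ + τ) - V * (t₀ + τ - t₀)))) + -1) := by
      gcongr; linarith
    linarith
  · refine continuousOn_const.add ((Continuous.continuousOn (by fun_prop)).sub
      (ContinuousOn.sub ?_ (W₁.continuousOn fun p hp => hp.2.2)))
    have := W₂.continuousOn (s := {p | p.1 ≤ h₂ p.2}) fun p hp => hp
    refine this.comp (f := fun p : ℝ × ℝ => (p.1, p.2 + S))
      (Continuous.continuousOn (by fun_prop)) ?_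
    rintro ⟨x, t⟩ ⟨-, -, hx⟩
    exact le_trans hx (hS t)
  · intro x _ hx
    have h1 := hord t₀ x hx
    have h2 : Real.exp (B * (x - (h₁ t₀ - V * (t₀ - t₀)))) ≤ 1 := by
      rw [Real.exp_le_one_iff]
      exact mul_nonpos_of_nonneg_of_nonpos (by linarith) (by linarith)
    have h3 : b' * (Real.exp (B * (x - (h₁ t₀ - V * (t₀ - t₀)))) + -1) ≤ 0 :=
      mul_nonpos_of_nonneg_of_nonpos hb'0.le (by linarith)
    linarith
  · intro t ht _
    have h1 := hord t (h₁ t - L - 1) (by linarith)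
    have h4 : V * (t - t₀) ≤ V * τ := by gcongr; linarith [ht.2]
    have h2 : Real.exp (B * (h₁ t - L - 1 - (h₁ t - V * (t - t₀)))) ≤ 1 := by
      rw [Real.exp_le_one_iff]
      exact mul_nonpos_of_nonneg_of_nonpos (by linarith) (by linarith)
    have h3 : b' * (Real.exp (B * (h₁ t - L - 1 - (h₁ t - V * (t - t₀)))) + -1) ≤ 0 :=
      mul_nonpos_of_nonneg_of_nonpos hb'0.le (by linarith)
    linarith
  · intro t ht _
    have h1 := T₁.front_gap T₂ hκ hτ hgap ht
    have h2 : b ≤ u₂ (h₁ t) (t + S) := by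
      refine le_trans ?_ (T₂.bounds.ge (t + S) (h₁ t) (hS t))
      rw [hb]; gcongr; linarith
    have h4 : V * (t - t₀) ≤ V * τ := by gcongr; linarith [ht.2]
    have h5 : b' * Real.exp (B * (h₁ t - (h₁ t - V * (t - t₀)))) ≤ b := by
      rw [← hbe]; gcongr; linarith
    simp only [W₁.sol.bdry t (mem_univ t)]
    linarith
  · intro t ht x _ hx k hk hUk
    have hx2 : x < h₂ (t + S) := hx.trans_le (hS t)
    have hθ : HasDerivAt (fun t => t + S) 1 t := (hasDerivAt_id' t).add_const S
    have hH : HasDerivAt (fun t => h₁ t - V * (t - t₀)) (deriv h₁ t - V * 1) t :=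
      (W₁.hasDerivAt_front t).sub (((hasDerivAt_id' t).sub_const t₀).const_mul V)
    refine ⟨_, _, _, _, _, _, (HasJet.const 1 x t).add
      (((hasJet_exp_front (r := B) (ζ := -1) hH).const_mul b').sub
      ((HasJet.reparam (θ := fun t => t + S) (W₂.hasJet hx2) hθ).sub (W₁.hasJet hx))),
      HasJet.const 1 x t, fun _ e2 => ?_⟩
    have ho := hord t x hx.le
    have hv0 := W₁.pos t x hx
    have hvM := T₁.bounds.le t x hx.le
    have hwM := T₂.bounds.le (t + S) x hx2.le
    have ha0 := T₁.hm.trans_le (T₁.ham x)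
    have hh0 := W₁.deriv_front_nonneg t
    rw [W₁.pde hx, W₂.pde hx2]
    set E := Real.exp (B * (x - (h₁ t - V * (t - t₀))))
    have hE0 : 0 < E := Real.exp_pos _
    set v := u₁ x t
    set w := u₂ x (t + S)
    have i1 : w - v ≤ b' * E := by linarith
    have i2 : (w - v) * (w + v - a x) ≤ b' * E * Γ := by
      have : w + v - a x ≤ Γ := by linarith
      calc (w - v) * (w + v - a x) ≤ (w - v) * Γ := by gcongr
        _ ≤ b' * E * Γ := by gcongr
    have i3 : 0 ≤ b' * E * (B * deriv h₁ t) := by positivity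
    have i4 : 0 < b' * E * (B * (B - V) - Γ) := by
      have : 0 < B * (B - V) - Γ := by nlinarith
      positivity
    linarith

end asymptotics

section rigidity

variable {μ m A M₁ K₁ c₁ M K c : ℝ} {a ustar : ℝ → ℝ} {u₁ u₂ : ℝ → ℝ → ℝ} {h₁ h₂ : ℝ → ℝ}

theorem exists_exp_neg_mul_le {r ρ : ℝ} (hr : 0 < r) (hρ : 0 < ρ) :
    ∃ L, 1 ≤ L ∧ Real.exp (-(r * L)) ≤ ρ := by
  refine ⟨max 1 (-Real.log ρ / r), le_max_left _ _, ?_⟩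
  rw [← Real.le_log_iff_exp_le hρ]
  have : -Real.log ρ ≤ r * max 1 (-Real.log ρ / r) := by
    calc -Real.log ρ = r * (-Real.log ρ / r) := by field_simp
      _ ≤ _ := by gcongr; exact le_max_right _ _
  linarith

/-- If the front of `u₁` is behind that of `u₂` at all times, and strictly behind at some time,
then it stays strictly behind afterwards, by a margin that depends only on the initial gap. -/
theorem TameSemiWave.persistent_gap (T₁ : TameSemiWave μ a ustar m A u₁ h₁ M₁ K₁ c₁)
    (T₂ : TameSemiWave μ a ustar m A u₂ h₂ M K c) {κ : ℝ} (hκ : 0 < κ) :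
    ∃ σ > 0, ∃ τ > 0, ∀ S, (∀ t, h₁ t ≤ h₂ (t + S)) → ∀ t₀, h₁ t₀ ≤ h₂ (t₀ + S - κ) →
      ∀ t, t₀ + τ ≤ t → h₁ t ≤ h₂ (t + (S - σ)) := by
  have hc := T₂.bounds.hc
  have hK := T₂.bounds.hK
  have hK₁ := T₁.bounds.hK
  have W₁ := T₁.wave
  have W₂ := T₂.wave
  obtain ⟨r, hr, hr1, δ, hδ, hw⟩ := T₂.exists_weight
  obtain ⟨q₀, hq₀, Q, hQ, hst⟩ := T₁.front_stability T₂ hr hr1 hδ hw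
  obtain ⟨C, hC, hinc⟩ := T₂.increment_le hr hr1 hδ hw
  obtain ⟨L, hL1, hL⟩ := exists_exp_neg_mul_le hr
    (ρ := min (c * q₀ / C) (c / (2 * C * Q))) (by positivity)
  set τ := c * κ / (2 * K₁) with hτ
  have hτ0 : 0 < τ := by positivity
  have hτ1 : K₁ * τ ≤ c * κ / 2 := by rw [hτ]; apply le_of_eq; field_simp
  obtain ⟨ρ, hρ, hspread⟩ := T₁.spreading T₂ hκ hτ0 hτ1 (L := L) (by linarith)
  set σ := min 1 (min (ρ / C) (c * κ / (4 * K))) with hσ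
  have hσ0 : 0 < σ := by positivity
  have hσ1 : σ ≤ 1 := min_le_left _ _
  have hσ2 : C * σ ≤ ρ := by
    calc C * σ ≤ C * (ρ / C) := by
          gcongr; exact (min_le_right _ _).trans (min_le_left _ _)
      _ = ρ := by field_simp
  have hσ3 : K * σ < c * κ / 2 := by
    calc K * σ ≤ K * (c * κ / (4 * K)) := by
          gcongr; exact (min_le_right _ _).trans (min_le_right _ _)
      _ = c * κ / 4 := by field_simp
      _ < c * κ / 2 := by
        have : 0 < c * κ := by positivity
        linarith
  set E := Real.exp (-(r * L)) with hE
  have hE0 : 0 < E := Real.exp_pos _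
  set q := C * σ * E / c with hq
  have hq0 : 0 < q := by positivity
  have hqq : q ≤ q₀ := by
    calc q ≤ C * 1 * (c * q₀ / C) / c := by
          rw [hq]; gcongr; exact hL.trans (min_le_left _ _)
      _ = q₀ := by field_simp
  have hQq : Q * q ≤ σ / 2 := by
    calc Q * q ≤ Q * (C * σ * (c / (2 * C * Q)) / c) := by
          rw [hq]; gcongr; exact hL.trans (min_le_right _ _)
      _ = σ / 2 := by field_simp
  refine ⟨σ / 2, by positivity, τ, hτ0, fun S hS t₀ hgap t ht => ?_⟩
  have hfr := T₁.front_gap T₂ hκ hτ1 hgap (t := t₀ + τ) ⟨by linarith, le_rfl⟩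
  have hsub := T₂.bounds.front_sub_le W₂.differentiable_front
    (s := t₀ + τ + S - σ) (t := t₀ + τ + S) (by linarith)
  have e1 : K * (t₀ + τ + S - (t₀ + τ + S - σ)) = K * σ := by ring
  have hlt : h₁ (t₀ + τ) < h₂ (t₀ + τ + S - σ) := by linarith
  refine (hst q hq0 hqq (t₀ + τ) (t₀ + τ + S - σ) hlt ?_ t ht).trans
    (W₂.mono.monotone (by linarith))
  intro x hx
  have hx2 : x ≤ h₂ (t₀ + τ + S - σ) := by linarith
  have h1 := hinc σ hσ0 (t₀ + τ + S - σ) x hx2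
  rw [sub_add_cancel] at h1
  have h2 := W₂.nonneg hx2
  have h3 : 0 ≤ q * u₂ x (t₀ + τ + S - σ) := by positivity
  rcases le_total (h₁ (t₀ + τ) - L) x with hx3 | hx3
  · have h4 := hspread S hS t₀ hgap x hx3 hx
    have h5 : Real.exp (r * (x - h₂ (t₀ + τ + S - σ))) ≤ 1 := by
      rw [Real.exp_le_one_iff]
      exact mul_nonpos_of_nonneg_of_nonpos hr.le (by linarith)
    have h6 : C * σ * Real.exp (r * (x - h₂ (t₀ + τ + S - σ))) ≤ C * σ * 1 := by gcongr
    linarith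
  · have h4 := W₁.le_of_front_le W₂ T₁.hm T₁.hstar T₁.bounds T₂.bounds
      (s := S) (t₁ := t₀ + τ) (fun t _ => hS t) x hx
    have h5 : Real.exp (r * (x - h₂ (t₀ + τ + S - σ))) ≤ E := by
      apply Real.exp_le_exp.2
      have : r * (x - h₂ (t₀ + τ + S - σ)) ≤ r * (-L) := by gcongr; linarith
      linarith
    have h6 : C * σ * Real.exp (r * (x - h₂ (t₀ + τ + S - σ))) ≤ C * σ * E := by gcongr
    have h7 := T₂.bounds.ge (t₀ + τ + S - σ) x hx2
    rw [min_eq_right (by linarith), mul_one] at h7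
    have h8 : C * σ * E ≤ q * u₂ x (t₀ + τ + S - σ) := by
      calc C * σ * E = q * c := by rw [hq]; field_simp
        _ ≤ _ := by gcongr
    linarith

theorem IsAPSemiWave.surjective_front {u : ℝ → ℝ → ℝ} {h : ℝ → ℝ}
    (W : IsAPSemiWave μ a ustar u h) : Function.Surjective h :=
  W.continuous_front.surjective W.tendsto_top W.tendsto_bot

/-- The front of one semi-wave is a time translate of the front of the other. -/
theorem TameSemiWave.front_eq_translate (T₁ : TameSemiWave μ a ustar m A u₁ h₁ M₁ K₁ c₁)
    (T₂ : TameSemiWave μ a ustar m A u₂ h₂ M K c) : ∃ S, ∀ t, h₁ t = h₂ (t + S) := by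
  have W₁ := T₁.wave
  have W₂ := T₂.wave
  choose b hb using fun t => W₂.surjective_front (h₁ t)
  have hle : ∀ t s, h₁ t ≤ h₂ s ↔ b t ≤ s := fun t s => by
    rw [← hb t]; exact W₂.mono.le_iff_le
  have hge : ∀ t s, h₂ s ≤ h₁ t ↔ s ≤ b t := fun t s => by
    rw [← hb t]; exact W₂.mono.le_iff_le
  obtain ⟨C, hC⟩ := T₁.front_le_add_const T₂
  obtain ⟨C', hC'⟩ := T₂.front_le_add_const T₁
  have hbdd : BddAbove (range fun t => b t - t) := by
    refine ⟨b 0 + max C C', ?_⟩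
    rintro _ ⟨t, rfl⟩
    change b t - t ≤ b 0 + max C C'
    rcases le_total 0 t with h | h
    · have := (hle _ _).1 (hC 0 (b 0) (hb 0).ge t h)
      linarith [le_max_left C C']
    · rcases le_total (-C') t with h' | h'
      · have : b t ≤ b 0 := (hle _ _).1 (by rw [hb]; exact W₁.mono.monotone h)
        linarith [le_max_right C C']
      · have := hC' (b t) t (hb t).le (b t - t - C') (by linarith)
        rw [show t + (b t - t - C' - b t) + C' = 0 by ring] at this
        have := (hge _ _).1 this
        linarith [le_max_right C C']
  set S := sSup (range fun t => b t - t) with hSdef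
  have hup : ∀ t, b t ≤ t + S := fun t => by
    linarith [le_csSup hbdd (mem_range_self t)]
  have hfront : ∀ t, h₁ t ≤ h₂ (t + S) := fun t => (hle _ _).2 (hup t)
  refine ⟨S, fun t₁ => ?_⟩
  by_contra hne
  have hlt : b t₁ < t₁ + S := by
    refine lt_of_le_of_ne (hup t₁) fun h => hne ?_
    rw [← hb, h]
  set κ := (t₁ + S - b t₁) / 2 with hκdef
  have hκ : 0 < κ := by rw [hκdef]; linarith
  obtain ⟨σ, hσ, τ, hτ, hgap⟩ := T₁.persistent_gap T₂ hκ
  have hearly : ∀ R, ∃ t ≤ R, h₁ t ≤ h₂ (t + S - κ) := by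
    intro R
    by_contra! hcon
    have h1 := T₂.front_le_of_front_le T₁ (s := κ - S) (t₁ := R - |S - κ|) (fun s hs => by
      have := hcon (s + (κ - S)) (by linarith [neg_le_abs (S - κ), le_abs_self (S - κ)])
      rw [show s + (κ - S) + S - κ = s by ring] at this
      exact this.le) (t₁ + S - κ)
    rw [show t₁ + S - κ + (κ - S) = t₁ by ring, hge] at h1
    linarith
  have hfin : S ≤ S - σ := by
    refine csSup_le (range_nonempty _) ?_
    rintro _ ⟨t, rfl⟩
    obtain ⟨t₀, ht₀, h0⟩ := hearly (t - τ)
    have := (hle _ _).1 (hgap S hfront t₀ h0 t (by linarith))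
    change b t - t ≤ S - σ
    linarith
  linarith

end rigidity

theorem semi_wave_unique_up_to_time_translation (μ : ℝ) (hμ : 0 < μ)
    (a ustar : ℝ → ℝ) (ha : BohrAlmostPeriodic a)
    (hainf : ∃ m > (0 : ℝ), ∀ x : ℝ, m ≤ a x)
    (hstar : IsBddPosSteadyState a ustar)
    (u₁ u₂ : ℝ → ℝ → ℝ) (h₁ h₂ : ℝ → ℝ)
    (hsw₁ : IsAPSemiWave μ a ustar u₁ h₁)
    (hsw₂ : IsAPSemiWave μ a ustar u₂ h₂) :
    ∃ t₀ : ℝ, (∀ t : ℝ, h₁ t = h₂ (t + t₀)) ∧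
      ∀ t : ℝ, ∀ x ≤ h₁ t, u₁ x t = u₂ x (t + t₀) := by
  obtain ⟨m, hm, ham⟩ := hainf
  obtain ⟨A, hA⟩ := bounded_of_almostPeriodic ha hstar.continuous_coeff
  have hs := hstar.lower_bound hm ham
  obtain ⟨M₁, K₁, c₁, F₁⟩ := hsw₁.frontBounds hμ hm ham hA hs
  obtain ⟨M, K, c, F₂⟩ := hsw₂.frontBounds hμ hm ham hA hs
  have T₁ : TameSemiWave μ a ustar m A u₁ h₁ M₁ K₁ c₁ := ⟨hsw₁, F₁, hμ, hm, ham, hA, hs⟩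
  have T₂ : TameSemiWave μ a ustar m A u₂ h₂ M K c := ⟨hsw₂, F₂, hμ, hm, ham, hA, hs⟩
  obtain ⟨S, hS⟩ := T₁.front_eq_translate T₂
  refine ⟨S, hS, fun t x hx => le_antisymm ?_ ?_⟩
  · exact hsw₁.le_of_front_le hsw₂ hm hs F₁ F₂ (fun t _ => (hS t).le) x hx
  · have := hsw₂.le_of_front_le hsw₁ hm hs F₂ F₁ (s := -S) (t₁ := t + S)
      (fun t _ => by rw [hS, neg_add_cancel_right]) x (by rwa [← hS])
    rwa [add_neg_cancel_right] at this
end
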